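/- Let n ≥ 3 and let A be an n-dimensional algebra having an ideal which, as an algebra, is isomorphic to the 2-dimensional algebra A_3 (with basis f_1,f_2 and multiplication f_1f_1 = f_2, other products zero). Then lev(A) = 2 if and only if A can be represented by the structure F^{α,β} ⊕ k^{n−3} for some (α,β) ∈ k²∖{(0,0)}. -/

import Mathlib

open scoped BigOperators

noncomputable section

/-- The space of `n`-dimensional (nonassociative) algebra structures on `kⁿ`:
bilinear maps `kⁿ × kⁿ → kⁿ`. -/
abbrev AlgStr (k : Type*) [Field k] (n : ℕ) : Type _ :=
  (Fin n → k) →ₗ[k] (Fin n → k) →ₗ[k] (Fin n → k)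

variable {k : Type*} [Field k]

/-- The algebra structure with prescribed structure constants `c`:
`μ(x, y) m = ∑ i, ∑ j, x i * y j * c i j m`. -/
def ofConst {n : ℕ} (c : Fin n → Fin n → Fin n → k) : AlgStr k n :=
  ∑ i, ∑ j,
    ((LinearMap.mul k k).compl₁₂ (LinearMap.proj i) (LinearMap.proj j)).compr₂
      (LinearMap.toSpanSingleton k (Fin n → k) (c i j))

/-- The structure constants of an algebra structure in the standard basis. -/
def structConst {n : ℕ} (μ : AlgStr k n) : Fin n × Fin n × Fin n → k :=
  fun t => μ (Pi.single t.1 1) (Pi.single t.2.1 1) t.2.2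

/-- A subset of `AlgStr k n` is Zariski closed if it is the common zero locus of a
family of polynomials in the structure constants. -/
def IsZariskiClosed {n : ℕ} (S : Set (AlgStr k n)) : Prop :=
  ∃ P : Set (MvPolynomial (Fin n × Fin n × Fin n) k),
    ∀ μ : AlgStr k n, μ ∈ S ↔ ∀ p ∈ P, MvPolynomial.eval (structConst μ) p = 0

/-- The action of `GL(V)` on algebra structures: `(g • μ)(x,y) = g (μ (g⁻¹ x) (g⁻¹ y))`. -/
def transport {n : ℕ} (g : (Fin n → k) ≃ₗ[k] (Fin n → k)) (μ : AlgStr k n) :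
    AlgStr k n :=
  ((μ.comp g.symm.toLinearMap).compl₂ g.symm.toLinearMap).compr₂ g.toLinearMap

/-- The `GL(V)`-orbit of an algebra structure; two structures represent isomorphic
algebras iff they lie in the same orbit. -/
def orbit {n : ℕ} (μ : AlgStr k n) : Set (AlgStr k n) :=
  {χ | ∃ g : (Fin n → k) ≃ₗ[k] (Fin n → k), transport g μ = χ}

/-- The Zariski closure of a set of algebra structures. -/
def zclosure {n : ℕ} (S : Set (AlgStr k n)) : Set (AlgStr k n) :=
  {χ | ∀ T : Set (AlgStr k n), IsZariskiClosed T → S ⊆ T → χ ∈ T}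

/-- `μ` degenerates to `χ` if `χ` lies in the Zariski closure of the orbit of `μ`. -/
def degenerates {n : ℕ} (μ χ : AlgStr k n) : Prop :=
  χ ∈ zclosure (orbit μ)

/-- A proper degeneration: additionally `χ` is not isomorphic to `μ`. -/
def properlyDegenerates {n : ℕ} (μ χ : AlgStr k n) : Prop :=
  degenerates μ χ ∧ χ ∉ orbit μ

/-- There is a chain of `m` proper degenerations starting at `μ`. -/
def hasChain {n : ℕ} (μ : AlgStr k n) (m : ℕ) : Prop :=
  ∃ c : ℕ → AlgStr k n, c m = μ ∧ ∀ i < m, properlyDegenerates (c (i + 1)) (c i)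

/-- The level of `μ` is `m`: there is a chain of `m` proper degenerations starting
at `μ` but no chain of `m+1`. -/
def levelIs {n : ℕ} (μ : AlgStr k n) (m : ℕ) : Prop :=
  hasChain μ m ∧ ¬ hasChain μ (m + 1)

/-- The subalgebra generated by a set `s`. -/
def subalgGen {n : ℕ} (μ : AlgStr k n) (s : Set (Fin n → k)) :
    Submodule k (Fin n → k) :=
  sInf {W | s ⊆ W ∧ ∀ x ∈ W, ∀ y ∈ W, μ x y ∈ W}

/-- The generation type of `μ` is `m`: `m` is the maximal dimension of a
one-generated subalgebra. -/
def genType {n : ℕ} (μ : AlgStr k n) (m : ℕ) : Prop :=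
  IsGreatest {d : ℕ | ∃ a : Fin n → k, Module.finrank k ↥(subalgGen μ {a}) = d} m

/-- A standard `1`-generated algebra: it admits a grading `A = ⊕_{i ≥ 1} A_i` with
`dim A_1 = 1`, `A_i A_j ⊆ A_{i+j}`, generated by `A_1` as an algebra. -/
def StandardOneGenerated {m : ℕ} (μ : AlgStr k m) : Prop :=
  ∃ A : ℕ → Submodule k (Fin m → k),
    A 0 = ⊥ ∧ DirectSum.IsInternal A ∧ Module.finrank k ↥(A 1) = 1 ∧
    (∀ i j : ℕ, ∀ x ∈ A i, ∀ y ∈ A j, μ x y ∈ A (i + j)) ∧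
    subalgGen μ ((A 1 : Submodule k (Fin m → k)) : Set (Fin m → k)) = ⊤

/-- Extension by zero of coordinates, `kᵐ → kⁿ`. -/
def inclMap (k : Type*) [Field k] {m n : ℕ} (h : m ≤ n) :
    (Fin m → k) →ₗ[k] (Fin n → k) where
  toFun x i := if hi : (i : ℕ) < m then x ⟨i, hi⟩ else 0
  map_add' x y := by funext i; by_cases hi : (i : ℕ) < m <;> simp [hi]
  map_smul' a x := by funext i; by_cases hi : (i : ℕ) < m <;> simp [hi]

/-- The `n`-dimensional algebra `B ⊕ k^{n-m}` obtained from an `m`-dimensional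
algebra `B` by adjoining a complement with all products zero. -/
def extendZero {m n : ℕ} (h : m ≤ n) (B : AlgStr k m) : AlgStr k n :=
  ((B.comp (LinearMap.funLeft k k (Fin.castLE h))).compl₂
      (LinearMap.funLeft k k (Fin.castLE h))).compr₂ (inclMap k h)

/-- The `i`-th standard basis vector (as a plain function, `0` if `i ≥ n`). -/
def unitVec {k : Type*} [Field k] (n i : ℕ) : Fin n → k :=
  fun j => if (j : ℕ) = i then 1 else 0

/-- Projection onto the coordinate `0` part. -/
def proj0 (k : Type*) [Field k] (n : ℕ) : (Fin n → k) →ₗ[k] (Fin n → k) :=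
  LinearMap.pi fun i => if (i : ℕ) = 0 then LinearMap.proj i else 0

/-- Projection onto the coordinates `≥ 1` part. -/
def projPos (k : Type*) [Field k] (n : ℕ) : (Fin n → k) →ₗ[k] (Fin n → k) :=
  LinearMap.pi fun i => if (i : ℕ) = 0 then 0 else LinearMap.proj i

/-- The Inönü–Wigner contraction of `μ` with respect to the `1`-dimensional
subalgebra spanned by the first basis vector (the remaining coordinates form the
square-zero ideal part). -/
def IWcontract0 {n : ℕ} (μ : AlgStr k n) : AlgStr k n :=
  ((μ.comp (projPos k n)).compl₂ (proj0 k n)).compr₂ (projPos k n) +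
    ((μ.comp (proj0 k n)).compl₂ (projPos k n)).compr₂ (projPos k n) +
    (μ.comp (proj0 k n)).compl₂ (proj0 k n)

/-- The annihilator of an algebra structure. -/
def annihilator {n : ℕ} (μ : AlgStr k n) : Submodule k (Fin n → k) where
  carrier := {a | ∀ b, μ a b = 0 ∧ μ b a = 0}
  add_mem' := by
    intro a b ha hb
    intro c
    constructor
    · rw [map_add, LinearMap.add_apply, (ha c).1, (hb c).1, add_zero]
    · rw [map_add, (ha c).2, (hb c).2, add_zero]
  zero_mem' := by
    intro b
    constructor
    · rw [map_zero, LinearMap.zero_apply]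
    · rw [map_zero]
  smul_mem' := by
    intro t a ha b
    constructor
    · rw [map_smul, LinearMap.smul_apply, (ha b).1, smul_zero]
    · rw [map_smul, (ha b).2, smul_zero]

/-- `μ` has a square-zero (two-sided) ideal of codimension `1`. -/
def hasSqZeroIdealCodim1 {n : ℕ} (μ : AlgStr k n) : Prop :=
  ∃ I : Submodule k (Fin n → k), Module.finrank k ↥I = n - 1 ∧
    (∀ x ∈ I, ∀ y : Fin n → k, μ x y ∈ I ∧ μ y x ∈ I) ∧
    ∀ x ∈ I, ∀ y ∈ I, μ x y = 0

/-- `a` (viewed as the sequence of parts `a 0 ≥ a 1 ≥ …`) is a partition of `N`. -/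
def IsPartitionOf (a : ℕ → ℕ) (N : ℕ) : Prop :=
  (∀ i j : ℕ, i ≤ j → a j ≤ a i) ∧
    ∃ l : ℕ, (∀ i, l ≤ i → a i = 0) ∧ ∑ i ∈ Finset.range l, a i = N

/-- The dominance order on partitions: `a ⪰ b`. -/
def Dominates (a b : ℕ → ℕ) : Prop :=
  ∀ m : ℕ, ∑ i ∈ Finset.range m, b i ≤ ∑ i ∈ Finset.range m, a i

/-- `a` is the Jordan type of the matrix `M` at the eigenvalue `lam`:
`a` is a partition of the generalized eigenspace dimension, and the parts of `a`
are the sizes of the Jordan blocks of `M` with eigenvalue `lam`, expressed via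
the ranks of powers of `M - lam • 1`. -/
def IsJordanTypeAt {N : ℕ} (M : Matrix (Fin N) (Fin N) k) (lam : k) (a : ℕ → ℕ) :
    Prop :=
  IsPartitionOf a (N - ((M - lam • (1 : Matrix (Fin N) (Fin N) k)) ^ N).rank) ∧
    ∀ p : ℕ, ((M - lam • (1 : Matrix (Fin N) (Fin N) k)) ^ p).rank =
      N - ∑ i ∈ Finset.range N, min (a i) p

/-- The full specter of `M` is `{(lam i, a i)}`: the `lam i` are pairwise distinct,
each `a i` is the (nonempty) Jordan type of `M` at `lam i`, and every eigenvalue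
of `M` occurs among the `lam i`. -/
def IsFullSpecter {N : ℕ} (M : Matrix (Fin N) (Fin N) k) {l : ℕ}
    (lam : Fin l → k) (a : Fin l → ℕ → ℕ) : Prop :=
  Function.Injective lam ∧
    (∀ i, IsJordanTypeAt M (lam i) (a i) ∧ a i 0 ≠ 0) ∧
    ∀ c : k, (∃ v : Fin N → k, v ≠ 0 ∧ M.mulVec v = c • v) → ∃ i, lam i = c

/-- There is a chain of `len` strict dominance steps of partitions of `N`
starting (on top) at `a`. -/
def partChain (a : ℕ → ℕ) (N len : ℕ) : Prop :=
  ∃ c : ℕ → ℕ → ℕ, (∀ i ≤ len, IsPartitionOf (c i) N) ∧ c len = a ∧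
    ∀ i < len, Dominates (c (i + 1)) (c i) ∧ c (i + 1) ≠ c i

/-- The structure `T_α^M ∈ A_{m+1}`. -/
def Tstr {m : ℕ} (α : k) (M : Matrix (Fin m) (Fin m) k) : AlgStr k (m + 1) :=
  ofConst fun i j mm =>
    if hi : i = 0 then
      if hj : j = 0 then (if mm = 0 then α else 0)
      else if hmm : mm = 0 then 0 else M (mm.pred hmm) (j.pred hj)
    else if hj : j = 0 then
      if hmm : mm = 0 then 0 else (if i = mm then α else 0) - M (mm.pred hmm) (i.pred hi)
    else 0

/-- The trivial singular extension `k^{n-2} ⋊_{(L₁,R₁,L₂,R₂)} χ` of the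
`2`-dimensional algebra `χ` given by the coefficients `c11, c12, c21, d12, d21, d22`
(with `χ(e₁,e₁) = c11·e₁ + e₂`, `χ(e₁,e₂) = c12·e₁ + d12·e₂`,
`χ(e₂,e₁) = c21·e₁ + d21·e₂`, `χ(e₂,e₂) = d22·e₂`). -/
def sdExt {m : ℕ} (c11 c12 c21 d12 d21 d22 : k)
    (L1 R1 L2 R2 : Matrix (Fin m) (Fin m) k) : AlgStr k (m + 2) :=
  ofConst fun i j mm =>
    if hi0 : (i : ℕ) = 0 then
      if hj0 : (j : ℕ) = 0 then
        if (mm : ℕ) = 0 then c11 else if (mm : ℕ) = 1 then 1 else 0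
      else if hj1 : (j : ℕ) = 1 then
        if (mm : ℕ) = 0 then c12 else if (mm : ℕ) = 1 then d12 else 0
      else if hmm : (mm : ℕ) < 2 then 0
      else L1 ⟨(mm : ℕ) - 2, by have := mm.isLt; omega⟩
             ⟨(j : ℕ) - 2, by have := j.isLt; omega⟩
    else if hi1 : (i : ℕ) = 1 then
      if hj0 : (j : ℕ) = 0 then
        if (mm : ℕ) = 0 then c21 else if (mm : ℕ) = 1 then d21 else 0
      else if hj1 : (j : ℕ) = 1 then
        if (mm : ℕ) = 1 then d22 else 0
      else if hmm : (mm : ℕ) < 2 then 0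
      else L2 ⟨(mm : ℕ) - 2, by have := mm.isLt; omega⟩
             ⟨(j : ℕ) - 2, by have := j.isLt; omega⟩
    else
      if hj0 : (j : ℕ) = 0 then
        if hmm : (mm : ℕ) < 2 then 0
        else R1 ⟨(mm : ℕ) - 2, by have := mm.isLt; omega⟩
               ⟨(i : ℕ) - 2, by have := i.isLt; omega⟩
      else if hj1 : (j : ℕ) = 1 then
        if hmm : (mm : ℕ) < 2 then 0
        else R2 ⟨(mm : ℕ) - 2, by have := mm.isLt; omega⟩
               ⟨(i : ℕ) - 2, by have := i.isLt; omega⟩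
      else 0

/-! Concrete algebra structures, given by multiplication tables on the standard
basis `e₁, …, eₙ` (0-indexed as `0, …, n-1`); all unspecified products are zero. -/

/-- `A₃ ⊕ k^{n-2}`: `e₁e₁ = e₂`. -/
def A3str (n : ℕ) : AlgStr k n :=
  ofConst fun i j m => if (i : ℕ) = 0 ∧ (j : ℕ) = 0 ∧ (m : ℕ) = 1 then 1 else 0

/-- `n₃ ⊕ k^{n-3}`: `e₁e₂ = e₃`, `e₂e₁ = -e₃`. -/
def n3str (n : ℕ) : AlgStr k n :=
  ofConst fun i j m =>
    if (i : ℕ) = 0 ∧ (j : ℕ) = 1 ∧ (m : ℕ) = 2 then 1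
    else if (i : ℕ) = 1 ∧ (j : ℕ) = 0 ∧ (m : ℕ) = 2 then -1
    else 0

/-- `p⁻`: `e₁eᵢ = eᵢ`, `eᵢe₁ = -eᵢ` for `i ≥ 2`. -/
def pminusStr (n : ℕ) : AlgStr k n :=
  ofConst fun i j m =>
    if (i : ℕ) = 0 ∧ 1 ≤ (j : ℕ) ∧ m = j then 1
    else if 1 ≤ (i : ℕ) ∧ (j : ℕ) = 0 ∧ m = i then -1
    else 0

/-- `ν^α`: `e₁e₁ = e₁`, `e₁eᵢ = α eᵢ`, `eᵢe₁ = (1-α) eᵢ` for `i ≥ 2`. -/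
def nuStr (n : ℕ) (α : k) : AlgStr k n :=
  ofConst fun i j m =>
    if (i : ℕ) = 0 then
      if (j : ℕ) = 0 then (if (m : ℕ) = 0 then 1 else 0)
      else (if m = j then α else 0)
    else if (j : ℕ) = 0 then (if m = i then 1 - α else 0)
    else 0

/-- `k^{n-2} ⋊ E₄`: `e₁e₁ = e₁`, `e₁e₂ = e₁ + e₂`, `e₂e₂ = e₂`,
`e₁eᵢ = eᵢ`, `eᵢe₂ = eᵢ` for `i ≥ 3`.  (For `n = 2` this is `E₄`.) -/
def kE4str (n : ℕ) : AlgStr k n :=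
  ofConst fun i j m =>
    if (i : ℕ) = 0 ∧ (j : ℕ) = 0 then (if (m : ℕ) = 0 then 1 else 0)
    else if (i : ℕ) = 0 ∧ (j : ℕ) = 1 then (if (m : ℕ) = 0 ∨ (m : ℕ) = 1 then 1 else 0)
    else if (i : ℕ) = 1 ∧ (j : ℕ) = 1 then (if (m : ℕ) = 1 then 1 else 0)
    else if (i : ℕ) = 0 ∧ 2 ≤ (j : ℕ) then (if m = j then 1 else 0)
    else if 2 ≤ (i : ℕ) ∧ (j : ℕ) = 1 then (if m = i then 1 else 0)
    else 0

/-- `T₀^{2,(α,β)}`: `e₁e₂ = αe₂ + e₃`, `e₂e₁ = -αe₂ - e₃`,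
`e₁eᵢ = βeᵢ`, `eᵢe₁ = -βeᵢ` for `i ≥ 3`. -/
def T02str (n : ℕ) (α β : k) : AlgStr k n :=
  ofConst fun i j m =>
    if (i : ℕ) = 0 ∧ (j : ℕ) = 1 then
      (if (m : ℕ) = 1 then α else if (m : ℕ) = 2 then 1 else 0)
    else if (i : ℕ) = 1 ∧ (j : ℕ) = 0 then
      (if (m : ℕ) = 1 then -α else if (m : ℕ) = 2 then -1 else 0)
    else if (i : ℕ) = 0 ∧ 2 ≤ (j : ℕ) then (if m = j then β else 0)
    else if 2 ≤ (i : ℕ) ∧ (j : ℕ) = 0 then (if m = i then -β else 0)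
    else 0

/-- `T₁^{2,(α,β)}`: `e₁e₁ = e₁`, `e₁e₂ = αe₂ + e₃`, `e₂e₁ = (1-α)e₂ - e₃`,
`e₁eᵢ = βeᵢ`, `eᵢe₁ = (1-β)eᵢ` for `i ≥ 3`. -/
def T12str (n : ℕ) (α β : k) : AlgStr k n :=
  ofConst fun i j m =>
    if (i : ℕ) = 0 ∧ (j : ℕ) = 0 then (if (m : ℕ) = 0 then 1 else 0)
    else if (i : ℕ) = 0 ∧ (j : ℕ) = 1 then
      (if (m : ℕ) = 1 then α else if (m : ℕ) = 2 then 1 else 0)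
    else if (i : ℕ) = 1 ∧ (j : ℕ) = 0 then
      (if (m : ℕ) = 1 then 1 - α else if (m : ℕ) = 2 then -1 else 0)
    else if (i : ℕ) = 0 ∧ 2 ≤ (j : ℕ) then (if m = j then β else 0)
    else if 2 ≤ (i : ℕ) ∧ (j : ℕ) = 0 then (if m = i then 1 - β else 0)
    else 0

/-- `T₀³`: `e₁e₂ = e₃`, `e₂e₁ = -e₃`, `e₁e₃ = e₄`, `e₃e₁ = -e₄`. -/
def T03str (n : ℕ) : AlgStr k n :=
  ofConst fun i j m =>
    if (i : ℕ) = 0 ∧ (j : ℕ) = 1 ∧ (m : ℕ) = 2 then 1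
    else if (i : ℕ) = 1 ∧ (j : ℕ) = 0 ∧ (m : ℕ) = 2 then -1
    else if (i : ℕ) = 0 ∧ (j : ℕ) = 2 ∧ (m : ℕ) = 3 then 1
    else if (i : ℕ) = 2 ∧ (j : ℕ) = 0 ∧ (m : ℕ) = 3 then -1
    else 0

/-- `T₀^{2,2}`: `e₁e₂ = e₃`, `e₂e₁ = -e₃`, `e₁e₄ = e₅`, `e₄e₁ = -e₅`. -/
def T022str (n : ℕ) : AlgStr k n :=
  ofConst fun i j m =>
    if (i : ℕ) = 0 ∧ (j : ℕ) = 1 ∧ (m : ℕ) = 2 then 1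
    else if (i : ℕ) = 1 ∧ (j : ℕ) = 0 ∧ (m : ℕ) = 2 then -1
    else if (i : ℕ) = 0 ∧ (j : ℕ) = 3 ∧ (m : ℕ) = 4 then 1
    else if (i : ℕ) = 3 ∧ (j : ℕ) = 0 ∧ (m : ℕ) = 4 then -1
    else 0

/-- `η_l ⊕ k^{n-2l-1}`: `e_{2i-1}e_{2i} = e_{2l+1}`, `e_{2i}e_{2i-1} = -e_{2l+1}`
for `1 ≤ i ≤ l`. -/
def etaStr (n l : ℕ) : AlgStr k n :=
  ofConst fun i j m =>
    if (i : ℕ) % 2 = 0 ∧ (j : ℕ) = (i : ℕ) + 1 ∧ (i : ℕ) < 2 * l ∧ (m : ℕ) = 2 * l then 1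
    else if (j : ℕ) % 2 = 0 ∧ (i : ℕ) = (j : ℕ) + 1 ∧ (j : ℕ) < 2 * l ∧ (m : ℕ) = 2 * l then -1
    else 0

/-- `F^{α,β} ⊕ k^{n-3}`: `e₁e₁ = e₃`, `e₁e₂ = αe₃`, `e₂e₁ = βe₃`. -/
def FabStr (n : ℕ) (α β : k) : AlgStr k n :=
  ofConst fun i j m =>
    if (i : ℕ) = 0 ∧ (j : ℕ) = 0 ∧ (m : ℕ) = 2 then 1
    else if (i : ℕ) = 0 ∧ (j : ℕ) = 1 ∧ (m : ℕ) = 2 then α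
    else if (i : ℕ) = 1 ∧ (j : ℕ) = 0 ∧ (m : ℕ) = 2 then β
    else 0

/-- `k^{n-2} ⋊ A₃`: `e₁e₁ = e₂`, `e₁eᵢ = eᵢ`, `eᵢe₁ = -eᵢ` for `i ≥ 3`. -/
def kA3str (n : ℕ) : AlgStr k n :=
  ofConst fun i j m =>
    if (i : ℕ) = 0 ∧ (j : ℕ) = 0 ∧ (m : ℕ) = 1 then 1
    else if (i : ℕ) = 0 ∧ 2 ≤ (j : ℕ) then (if m = j then 1 else 0)
    else if 2 ≤ (i : ℕ) ∧ (j : ℕ) = 0 then (if m = i then -1 else 0)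
    else 0

/-- `k² ⋊_{α,β} A₃ ⊕ k^{n-4}`: `e₁e₁ = e₂`, `e₁e₃ = αe₄`, `e₃e₁ = βe₄`. -/
def k2A3str (n : ℕ) (α β : k) : AlgStr k n :=
  ofConst fun i j m =>
    if (i : ℕ) = 0 ∧ (j : ℕ) = 0 ∧ (m : ℕ) = 1 then 1
    else if (i : ℕ) = 0 ∧ (j : ℕ) = 2 ∧ (m : ℕ) = 3 then α
    else if (i : ℕ) = 2 ∧ (j : ℕ) = 0 ∧ (m : ℕ) = 3 then β
    else 0

/-- `k^{n-2} ⋊_α A₁^α`: `e₁e₁ = e₁ + e₂`, `e₁eᵢ = αeᵢ`, `eᵢe₁ = (1-α)eᵢ` for `i ≥ 2`. -/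
def kA1str (n : ℕ) (α : k) : AlgStr k n :=
  ofConst fun i j m =>
    if (i : ℕ) = 0 ∧ (j : ℕ) = 0 then (if (m : ℕ) = 0 ∨ (m : ℕ) = 1 then 1 else 0)
    else if (i : ℕ) = 0 then (if m = j then α else 0)
    else if (j : ℕ) = 0 then (if m = i then 1 - α else 0)
    else 0

/-- `k^{n-2} ⋊₁ A₂`: `e₁e₁ = e₂`, `e₁eᵢ = eᵢ`, `eᵢe₁ = -eᵢ` for `i ≥ 2`. -/
def kA2str (n : ℕ) : AlgStr k n :=
  ofConst fun i j m =>
    if (i : ℕ) = 0 ∧ (j : ℕ) = 0 then (if (m : ℕ) = 1 then 1 else 0)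
    else if (i : ℕ) = 0 then (if m = j then 1 else 0)
    else if (j : ℕ) = 0 then (if m = i then -1 else 0)
    else 0

/-- `k^{n-2} ⋊₀ᵗ B₂^α`: `e₁eᵢ = αeᵢ`, `eᵢe₁ = (1-α)eᵢ` for `i ≥ 2`. -/
def ktB2str (n : ℕ) (α : k) : AlgStr k n :=
  ofConst fun i j m =>
    if (i : ℕ) = 0 ∧ 1 ≤ (j : ℕ) then (if m = j then α else 0)
    else if 1 ≤ (i : ℕ) ∧ (j : ℕ) = 0 then (if m = i then 1 - α else 0)
    else 0

/-- `k^{n-2} ⋊₀ᵗ D₂^{α,β}`: `e₁e₁ = e₁`, `e₁eᵢ = αeᵢ`, `eᵢe₁ = βeᵢ` for `i ≥ 2`. -/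
def ktD2str (n : ℕ) (α β : k) : AlgStr k n :=
  ofConst fun i j m =>
    if (i : ℕ) = 0 ∧ (j : ℕ) = 0 then (if (m : ℕ) = 0 then 1 else 0)
    else if (i : ℕ) = 0 then (if m = j then α else 0)
    else if (j : ℕ) = 0 then (if m = i then β else 0)
    else 0


section AlgebraStructures

variable {n : ℕ}

theorem algStr_apply_eq_sum (μ : AlgStr k n) (x y : Fin n → k) (m : Fin n) :
    μ x y m = ∑ i, ∑ j, x i * y j * structConst μ (i, j, m) := by
  have hx : ∀ z : Fin n → k, z = ∑ i, z i • (Pi.single i 1 : Fin n → k) := fun z => by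
    simpa using ((Pi.basisFun k (Fin n)).sum_repr z).symm
  conv_lhs => rw [hx x, hx y]
  simp only [map_sum, map_smul, LinearMap.sum_apply, LinearMap.smul_apply, Finset.sum_apply,
    Pi.smul_apply, smul_eq_mul, structConst, Finset.mul_sum, mul_assoc]
  rw [Finset.sum_comm]
  refine Finset.sum_congr rfl fun i _ => Finset.sum_congr rfl fun j _ => by ring

theorem structConst_injective : Function.Injective (structConst : AlgStr k n → _) := by
  intro μ ν h
  refine LinearMap.ext fun x => LinearMap.ext fun y => funext fun m => ?_
  rw [algStr_apply_eq_sum, algStr_apply_eq_sum, h]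

theorem structConst_ofConst (c : Fin n → Fin n → Fin n → k) (i j m : Fin n) :
    structConst (ofConst c) (i, j, m) = c i j m := by
  simp [structConst, ofConst, Pi.single_apply, ite_apply]

/-! ### Orbits -/

theorem transport_apply (g : (Fin n → k) ≃ₗ[k] (Fin n → k)) (μ : AlgStr k n)
    (x y : Fin n → k) : transport g μ x y = g (μ (g.symm x) (g.symm y)) := rfl

theorem mem_orbit_iff {μ χ : AlgStr k n} :
    χ ∈ orbit μ ↔ ∃ g : (Fin n → k) ≃ₗ[k] (Fin n → k), ∀ x y, χ (g x) (g y) = g (μ x y) := by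
  constructor
  · rintro ⟨g, rfl⟩
    exact ⟨g, fun x y => by simp [transport_apply]⟩
  · rintro ⟨g, hg⟩
    refine ⟨g, LinearMap.ext fun x => LinearMap.ext fun y => ?_⟩
    rw [transport_apply, ← hg]
    simp

theorem mem_orbit_self (μ : AlgStr k n) : μ ∈ orbit μ :=
  mem_orbit_iff.2 ⟨LinearEquiv.refl k _, fun _ _ => rfl⟩

theorem mem_orbit_symm {μ χ : AlgStr k n} (h : χ ∈ orbit μ) : μ ∈ orbit χ := by
  obtain ⟨g, hg⟩ := mem_orbit_iff.1 h
  refine mem_orbit_iff.2 ⟨g.symm, fun x y => ?_⟩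
  rw [LinearEquiv.eq_symm_apply, ← hg]
  simp

theorem mem_orbit_trans {μ χ ν : AlgStr k n} (h : χ ∈ orbit μ) (h' : ν ∈ orbit χ) :
    ν ∈ orbit μ := by
  obtain ⟨g, hg⟩ := mem_orbit_iff.1 h
  obtain ⟨g', hg'⟩ := mem_orbit_iff.1 h'
  exact mem_orbit_iff.2 ⟨g.trans g', fun x y => by simp [hg, hg']⟩

theorem orbit_eq_of_mem {μ χ : AlgStr k n} (h : χ ∈ orbit μ) : orbit χ = orbit μ :=
  Set.ext fun _ => ⟨mem_orbit_trans h, mem_orbit_trans (mem_orbit_symm h)⟩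

theorem eq_zero_of_mem_orbit_zero {χ : AlgStr k n} (h : χ ∈ orbit (0 : AlgStr k n)) :
    χ = 0 := by
  obtain ⟨g, rfl⟩ := h
  refine LinearMap.ext fun x => LinearMap.ext fun y => ?_
  simp [transport_apply]

theorem mem_orbit_ofConst (β : Module.Basis (Fin n) k (Fin n → k)) (μ : AlgStr k n)
    (c : Fin n → Fin n → Fin n → k)
    (h : ∀ i j m, β.repr (μ (β i) (β j)) m = c i j m) : μ ∈ orbit (ofConst c) := by
  refine mem_orbit_symm ⟨β.equivFun, structConst_injective (funext fun ⟨i, j, m⟩ => ?_)⟩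
  rw [structConst_ofConst, ← h]
  simp [structConst, transport_apply]

/-! ### Polynomial functions and degenerations -/

/-- A function of the structure given by a polynomial in the structure constants. -/
def IsPolyFun (F : AlgStr k n → k) : Prop :=
  ∃ p : MvPolynomial (Fin n × Fin n × Fin n) k, ∀ μ, F μ = MvPolynomial.eval (structConst μ) p

namespace IsPolyFun

theorem const (a : k) : IsPolyFun (fun _ : AlgStr k n => a) :=
  ⟨MvPolynomial.C a, fun _ => by simp⟩

theorem add {F G : AlgStr k n → k} (hF : IsPolyFun F) (hG : IsPolyFun G) :
    IsPolyFun (fun μ => F μ + G μ) := by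
  obtain ⟨p, hp⟩ := hF
  obtain ⟨q, hq⟩ := hG
  exact ⟨p + q, fun μ => by simp [hp, hq]⟩

theorem mul {F G : AlgStr k n → k} (hF : IsPolyFun F) (hG : IsPolyFun G) :
    IsPolyFun (fun μ => F μ * G μ) := by
  obtain ⟨p, hp⟩ := hF
  obtain ⟨q, hq⟩ := hG
  exact ⟨p * q, fun μ => by simp [hp, hq]⟩

theorem sub {F G : AlgStr k n → k} (hF : IsPolyFun F) (hG : IsPolyFun G) :
    IsPolyFun (fun μ => F μ - G μ) := by
  obtain ⟨p, hp⟩ := hF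
  obtain ⟨q, hq⟩ := hG
  exact ⟨p - q, fun μ => by simp [hp, hq]⟩

theorem sum {ι : Type*} (s : Finset ι) {F : ι → AlgStr k n → k} (hF : ∀ i, IsPolyFun (F i)) :
    IsPolyFun (fun μ => ∑ i ∈ s, F i μ) := by
  choose p hp using hF
  exact ⟨∑ i ∈ s, p i, fun μ => by simp [hp]⟩

theorem apply (x y : Fin n → k) (m : Fin n) : IsPolyFun (fun μ : AlgStr k n => μ x y m) := by
  refine ⟨∑ i, ∑ j, MvPolynomial.C (x i * y j) * MvPolynomial.X (i, j, m), fun μ => ?_⟩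
  simp [algStr_apply_eq_sum μ x y m]

theorem apply_apply_left (x y z : Fin n → k) (m : Fin n) :
    IsPolyFun (fun μ : AlgStr k n => μ (μ x y) z m) := by
  have h : (fun μ : AlgStr k n => μ (μ x y) z m) =
      fun μ => ∑ i, μ x y i * μ (Pi.single i 1) z m := by
    funext μ
    have hx : μ x y = ∑ i, μ x y i • (Pi.single i 1 : Fin n → k) := by
      simpa using ((Pi.basisFun k (Fin n)).sum_repr (μ x y)).symm
    conv_lhs => rw [hx]
    simp
  rw [h]
  exact sum _ fun i => (apply x y i).mul (apply _ z m)

theorem apply_apply_right (x y z : Fin n → k) (m : Fin n) :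
    IsPolyFun (fun μ : AlgStr k n => μ z (μ x y) m) := by
  have h : (fun μ : AlgStr k n => μ z (μ x y) m) =
      fun μ => ∑ i, μ x y i * μ z (Pi.single i 1) m := by
    funext μ
    have hx : μ x y = ∑ i, μ x y i • (Pi.single i 1 : Fin n → k) := by
      simpa using ((Pi.basisFun k (Fin n)).sum_repr (μ x y)).symm
    conv_lhs => rw [hx]
    simp
  rw [h]
  exact sum _ fun i => (apply x y i).mul (apply z _ m)

end IsPolyFun

theorem degenerates.eq_zero_of_isPolyFun {μ χ : AlgStr k n} (h : degenerates μ χ)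
    {F : AlgStr k n → k} (hF : IsPolyFun F) (h0 : ∀ ν ∈ orbit μ, F ν = 0) : F χ = 0 := by
  obtain ⟨p, hp⟩ := hF
  exact h {ν | F ν = 0} ⟨{p}, fun ν => by simp [hp]⟩ h0

theorem degenerates_of_polynomial_curve [Infinite k] {μ χ : AlgStr k n}
    (Q : Fin n × Fin n × Fin n → Polynomial k) (hχ : ∀ s, structConst χ s = (Q s).eval 0)
    (hQ : ∀ t : k, t ≠ 0 → ∃ ν ∈ orbit μ, ∀ s, structConst ν s = (Q s).eval t) :
    degenerates μ χ := by
  rintro T ⟨P, hP⟩ hT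
  rw [hP]
  intro p hp
  have heval : ∀ t : k, (MvPolynomial.aeval Q p).eval t =
      MvPolynomial.eval (fun s => (Q s).eval t) p := fun t => by
    clear hp
    induction p using MvPolynomial.induction_on with
    | C a => simp
    | add p q hp hq => simp [hp, hq]
    | mul_X p i hp => simp [hp]
  have hz : MvPolynomial.aeval Q p = 0 := by
    refine Polynomial.eq_zero_of_infinite_isRoot _ ((Set.finite_singleton (0 : k)).infinite_compl.mono ?_)
    intro t ht
    obtain ⟨ν, hν, hs⟩ := hQ t ht
    have := (hP ν).1 (hT hν) p hp
    rw [funext hs] at this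
    simpa [Polynomial.IsRoot, heval] using this
  rw [funext hχ, ← heval, hz, Polynomial.eval_zero]

theorem degenerates_of_quadratic_curve [Infinite k] {μ : AlgStr k n} (χ : k → AlgStr k n)
    (hχ : ∀ x y m, ∃ a b c : k, ∀ t, χ t x y m = a + b * t + c * t ^ 2)
    (h : ∀ t, t ≠ 0 → χ t ∈ orbit μ) : degenerates μ (χ 0) := by
  choose a b c habc using hχ
  refine degenerates_of_polynomial_curve (fun s =>
    Polynomial.C (a (Pi.single s.1 1) (Pi.single s.2.1 1) s.2.2) +
    Polynomial.C (b (Pi.single s.1 1) (Pi.single s.2.1 1) s.2.2) * Polynomial.X +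
    Polynomial.C (c (Pi.single s.1 1) (Pi.single s.2.1 1) s.2.2) * Polynomial.X ^ 2)
    (fun s => ?_) fun t ht => ⟨χ t, h t ht, fun s => ?_⟩ <;> simp [structConst, habc]

theorem degenerates_zero [Infinite k] (μ : AlgStr k n) : degenerates μ 0 := by
  have := degenerates_of_quadratic_curve (μ := μ) (fun t => t • μ)
    (fun x y m => ⟨0, μ x y m, 0, fun t => by simp [mul_comm]⟩) fun t ht => by
      refine mem_orbit_iff.2 ⟨(LinearEquiv.smulOfNeZero k (Fin n → k) t ht).symm, fun x y => ?_⟩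
      rw [LinearEquiv.eq_symm_apply]
      have key : ∀ x, t • (LinearEquiv.smulOfNeZero k (Fin n → k) t ht).symm x = x := fun x =>
        (LinearEquiv.smulOfNeZero k (Fin n → k) t ht).apply_symm_apply x
      rw [LinearEquiv.smulOfNeZero_apply, LinearMap.smul_apply, LinearMap.smul_apply,
        ← LinearMap.smul_apply, ← map_smul, ← map_smul, key, key]
  simpa using this

theorem degenerates_of_weights [Infinite k] (μ : AlgStr k n) (w : Fin n → ℕ)
    (hw : ∀ i j m, w m ≤ w i + w j) :
    degenerates μ (ofConst fun i j m =>
      if w i + w j = w m then structConst μ (i, j, m) else 0) := by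
  refine degenerates_of_polynomial_curve (fun s =>
    Polynomial.C (structConst μ s) * Polynomial.X ^ (w s.1 + w s.2.1 - w s.2.2)) ?_ ?_
  · rintro ⟨i, j, m⟩
    have := hw i j m
    rw [structConst_ofConst]
    split_ifs with h
    · simp [h]
    · have : w i + w j - w m ≠ 0 := by omega
      simp [this]
  · intro t ht
    let g : (Fin n → k) ≃ₗ[k] (Fin n → k) :=
      LinearEquiv.piCongrRight fun i => (LinearEquiv.smulOfNeZero k k (t ^ w i) (pow_ne_zero _ ht)).symm
    have hg : ∀ i, g.symm (Pi.single i 1) = t ^ w i • Pi.single i 1 := fun i => by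
      rw [LinearEquiv.symm_apply_eq]
      funext j
      simp only [g, LinearEquiv.piCongrRight_apply]
      rw [LinearEquiv.eq_symm_apply]
      by_cases hij : j = i
      · subst hij; simp
      · simp [hij]
    have hg' : ∀ x m, g x m = (t ^ w m)⁻¹ * x m := fun x m => by
      simp only [g, LinearEquiv.piCongrRight_apply]
      rw [LinearEquiv.symm_apply_eq]
      simp [ht]
    refine ⟨transport g μ, ⟨g, rfl⟩, ?_⟩
    rintro ⟨i, j, m⟩
    have h := hw i j m
    simp only [structConst, transport_apply, hg, hg', map_smul, LinearMap.smul_apply,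
      Pi.smul_apply, smul_eq_mul, Polynomial.eval_mul, Polynomial.eval_C, Polynomial.eval_pow,
      Polynomial.eval_X]
    rw [pow_sub₀ _ ht h, pow_add]
    ring

theorem degenerates_congr_left {μ μ' χ : AlgStr k n} (h : μ' ∈ orbit μ) :
    degenerates μ' χ ↔ degenerates μ χ := by
  rw [degenerates, degenerates, orbit_eq_of_mem h]

theorem properlyDegenerates_congr_left {μ μ' χ : AlgStr k n} (h : μ' ∈ orbit μ) :
    properlyDegenerates μ' χ ↔ properlyDegenerates μ χ := by
  rw [properlyDegenerates, properlyDegenerates, degenerates_congr_left h, orbit_eq_of_mem h]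

theorem hasChain_zero (μ : AlgStr k n) : hasChain μ 0 :=
  ⟨fun _ => μ, rfl, fun i hi => absurd hi (Nat.not_lt_zero i)⟩

theorem hasChain_succ {μ : AlgStr k n} {m : ℕ} :
    hasChain μ (m + 1) ↔ ∃ χ, properlyDegenerates μ χ ∧ hasChain χ m := by
  constructor
  · rintro ⟨c, rfl, hc⟩
    exact ⟨c m, hc m m.lt_succ_self, c, rfl, fun i hi => hc i (hi.trans m.lt_succ_self)⟩
  · rintro ⟨χ, hχ, c, rfl, hc⟩
    refine ⟨fun i => if i ≤ m then c i else μ, by simp, fun i hi => ?_⟩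
    rcases (Nat.lt_succ_iff.1 hi).lt_or_eq with h | rfl
    · simpa [h.le, Nat.succ_le_of_lt h] using hc i h
    · simpa using hχ

theorem hasChain_one [Infinite k] {μ : AlgStr k n} (h : μ ≠ 0) : hasChain μ 1 :=
  hasChain_succ.2 ⟨0, ⟨degenerates_zero μ, fun h0 =>
    h (eq_zero_of_mem_orbit_zero (mem_orbit_symm h0))⟩, hasChain_zero 0⟩

theorem hasChain_congr {μ μ' : AlgStr k n} (h : μ' ∈ orbit μ) (m : ℕ) :
    hasChain μ' m ↔ hasChain μ m := by
  cases m with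
  | zero => exact iff_of_true (hasChain_zero _) (hasChain_zero _)
  | succ m => simp_rw [hasChain_succ, properlyDegenerates_congr_left h]

end AlgebraStructures
section BilinearForms

/-- A bilinear form over an algebraically closed field is alternating, or the square of a linear
form, or restricts to a plane with Gram matrix `[[1, α], [β, 0]]`, where `(α, β) ≠ (0, 0)`. -/
theorem bilinForm_trichotomy [IsAlgClosed k] {H : Type*} [AddCommGroup H] [Module k H]
    (b : H →ₗ[k] H →ₗ[k] k) :
    (∀ x, b x x = 0) ∨
      (∃ e, b e e = 1 ∧ (∀ x, b x e = b e x) ∧ ∀ x y, b x y = b e x * b e y) ∨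
      ∃ e u, b e e = 1 ∧ b u u = 0 ∧ ¬ (b e u = 0 ∧ b u e = 0) := by
  by_cases halt : ∀ x, b x x = 0
  · exact .inl halt
  refine .inr ?_
  by_contra! hcon
  obtain ⟨hsq, hiso⟩ := hcon
  push Not at halt
  obtain ⟨e₀, he₀⟩ := halt
  obtain ⟨s, hs⟩ := IsAlgClosed.exists_pow_nat_eq (b e₀ e₀)⁻¹ two_pos
  obtain ⟨e, he⟩ : ∃ e, b e e = 1 := ⟨s • e₀, by
    simp only [map_smul, LinearMap.smul_apply, smul_eq_mul]
    rw [← mul_assoc, ← sq, hs, inv_mul_cancel₀ he₀]⟩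
  have hdiag : ∀ x, b x e = b e x ∧ b x x = b e x ^ 2 := fun x => by
    have hdeg : (Polynomial.X ^ 2 + Polynomial.C (b x e + b e x) * Polynomial.X +
        Polynomial.C (b x x)).degree = 2 := by compute_degree!
    obtain ⟨s, hs⟩ := IsAlgClosed.exists_root _ (hdeg.trans_ne two_ne_zero)
    simp only [Polynomial.IsRoot, Polynomial.eval_add, Polynomial.eval_mul, Polynomial.eval_pow,
      Polynomial.eval_X, Polynomial.eval_C] at hs
    have h := hiso e (x + s • e) he (by
      simp only [map_add, map_smul, LinearMap.add_apply, LinearMap.smul_apply, smul_eq_mul, he]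
      linear_combination hs)
    simp only [map_add, map_smul, LinearMap.add_apply, LinearMap.smul_apply, smul_eq_mul, he] at h
    have h1 : b e x = -s := by linear_combination h.1
    have h2 : b x e = -s := by linear_combination h.2
    rw [h1, h2] at hs ⊢
    exact ⟨rfl, by linear_combination hs⟩
  have hker : ∀ x y, b e x = 0 → b e y = 0 → b x y = 0 := fun x y hx hy => by
    have hx' := hdiag x
    have hy' := hdiag y
    rw [hx] at hx'
    rw [hy] at hy'
    have h := (hiso (e + x) y (by simp [hx, hx', he]) (by simp [hy'])).1
    simpa [hy] using h
  obtain ⟨x, y, hxy⟩ := hsq e he fun x => (hdiag x).1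
  apply hxy
  have h := hker (x - b e x • e) (y - b e y • e) (by simp [he]) (by simp [he])
  simp only [map_sub, map_smul, LinearMap.sub_apply, LinearMap.smul_apply, smul_eq_mul, he,
    (hdiag _).1] at h
  linear_combination h

/-- A partial basis, given at the positions in `s`, completed by vectors of a submodule `K`. -/
theorem exists_basis_extend {n : ℕ} (s : Finset (Fin n)) (f : Fin n → Fin n → k)
    (hf : LinearIndepOn k f (s : Set (Fin n))) (K : Submodule k (Fin n → k))
    (hK : Submodule.span k (f '' s) ⊔ K = ⊤) :
    ∃ β : Module.Basis (Fin n) k (Fin n → k), (∀ i ∈ s, β i = f i) ∧ ∀ i ∉ s, β i ∈ K := by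
  classical
  have hf' : LinearIndepOn k id (f '' s) := hf.id_image
  have hst : f '' s ⊆ f '' s ∪ K := Set.subset_union_left
  let γ := Module.Basis.extendLe hf' hst (by rw [Submodule.span_union, Submodule.span_eq, hK])
  have hfin : (hf'.extend hst).Finite := by
    have := Module.Finite.finite_basis γ
    exact Set.toFinite _
  have hcard : Fintype.card (Fin n) = hfin.toFinset.card := by
    have := hfin.fintype
    rw [← Module.finrank_eq_card_basis (Pi.basisFun k (Fin n)), Module.finrank_eq_card_basis γ,
      Set.Finite.card_toFinset]
  obtain ⟨g, hg⟩ := Finset.exists_equiv_extend_of_card_eq hcard (s := s) (f := f)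
    (fun x hx => by
      rw [Set.Finite.mem_toFinset]
      refine hf'.subset_extend hst ?_
      simpa using hx) hf.injOn
  let e : hfin.toFinset ≃ hf'.extend hst := Equiv.subtypeEquivRight fun _ => hfin.mem_toFinset
  have hβ : ∀ i, γ.reindex (g.trans e).symm i = g i := fun i => by
    simp [γ, e]
  refine ⟨γ.reindex (g.trans e).symm, fun i hi => (hβ i).trans (hg i hi), fun i hi => ?_⟩
  rw [hβ]
  rcases hf'.extend_subset hst (hfin.mem_toFinset.1 (g i).2) with ⟨j, hj, hij⟩ | h
  · rw [← hg j hj] at hij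
    exact absurd (g.injective (Subtype.ext hij) ▸ hj) hi
  · exact h

end BilinearForms
section TwoForms

variable {n : ℕ}

theorem exists_basis_extend_triple (hn : 3 ≤ n) (e u v : Fin n → k)
    (hind : ∀ a b c : k, a • e + b • u + c • v = 0 → a = 0 ∧ b = 0 ∧ c = 0)
    (K : Submodule k (Fin n → k)) (hK : ∀ x, ∃ a b c : k, x - (a • e + b • u + c • v) ∈ K) :
    ∃ β : Module.Basis (Fin n) k (Fin n → k), β ⟨0, by omega⟩ = e ∧ β ⟨1, by omega⟩ = u ∧
      β ⟨2, by omega⟩ = v ∧ ∀ i : Fin n, 3 ≤ (i : ℕ) → β i ∈ K := by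
  let f : Fin n → Fin n → k := fun i =>
    if (i : ℕ) = 0 then e else if (i : ℕ) = 1 then u else v
  let s : Finset (Fin n) := {⟨0, by omega⟩, ⟨1, by omega⟩, ⟨2, by omega⟩}
  obtain ⟨β, hβ, hβ'⟩ := exists_basis_extend s f (by
    rw [linearIndepOn_finset_iff]
    intro g hg
    simp only [s, f] at hg
    rw [Finset.sum_insert (by simp), Finset.sum_insert (by simp), Finset.sum_singleton] at hg
    have := hind _ _ _ (by simpa [← add_assoc] using hg)
    simpa [s] using this) K (by
    rw [eq_top_iff]
    rintro x -
    obtain ⟨a, b, c, h⟩ := hK x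
    have hmem : ∀ i ∈ s, f i ∈ Submodule.span k (f '' s) := fun i hi =>
      Submodule.subset_span ⟨i, hi, rfl⟩
    refine Submodule.mem_sup.2 ⟨a • e + b • u + c • v, ?_, _, h, by abel⟩
    exact add_mem (add_mem (Submodule.smul_mem _ _ (by simpa [f] using hmem ⟨0, by omega⟩ (by simp [s])))
      (Submodule.smul_mem _ _ (by simpa [f] using hmem ⟨1, by omega⟩ (by simp [s]))))
      (Submodule.smul_mem _ _ (by simpa [f] using hmem ⟨2, by omega⟩ (by simp [s]))))
  refine ⟨β, ?_, ?_, ?_, fun i hi => hβ' i ?_⟩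
  · simpa [f] using hβ ⟨0, by omega⟩ (by simp [s])
  · simpa [f] using hβ ⟨1, by omega⟩ (by simp [s])
  · simpa [f] using hβ ⟨2, by omega⟩ (by simp [s])
  · simp only [s, Finset.mem_insert, Finset.mem_singleton, Fin.ext_iff]
    omega

/-- The algebra structure `(x, y) ↦ b(x, y) v`. -/
def formStr (b : (Fin n → k) →ₗ[k] (Fin n → k) →ₗ[k] k) (v : Fin n → k) : AlgStr k n :=
  b.compr₂ (LinearMap.toSpanSingleton k (Fin n → k) v)

@[simp]
theorem formStr_apply (b : (Fin n → k) →ₗ[k] (Fin n → k) →ₗ[k] k) (v x y : Fin n → k) :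
    formStr b v x y = b x y • v := rfl

theorem FabStr_apply (hn : 3 ≤ n) (α β : k) (x y : Fin n → k) :
    FabStr n α β x y = (x ⟨0, by omega⟩ * y ⟨0, by omega⟩ + α * (x ⟨0, by omega⟩ * y ⟨1, by omega⟩) +
      β * (x ⟨1, by omega⟩ * y ⟨0, by omega⟩)) • Pi.single ⟨2, by omega⟩ 1 := by
  let p : Fin n → Fin n → (Fin n → k) →ₗ[k] (Fin n → k) →ₗ[k] k := fun i j =>
    (LinearMap.mul k k).compl₁₂ (LinearMap.proj i) (LinearMap.proj j)
  have : FabStr n α β = formStr (p ⟨0, by omega⟩ ⟨0, by omega⟩ + α • p ⟨0, by omega⟩ ⟨1, by omega⟩ +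
      β • p ⟨1, by omega⟩ ⟨0, by omega⟩) (Pi.single ⟨2, by omega⟩ 1) := by
    refine structConst_injective (funext fun ⟨i, j, m⟩ => ?_)
    rw [FabStr, structConst_ofConst]
    simp only [structConst, formStr_apply, p, LinearMap.add_apply, LinearMap.smul_apply,
      LinearMap.compl₁₂_apply, LinearMap.proj_apply, LinearMap.mul_apply', Pi.single_apply,
      Pi.smul_apply, smul_eq_mul, Fin.ext_iff]
    grind
  rw [this]
  simp [p]

theorem n3str_apply (hn : 3 ≤ n) (x y : Fin n → k) :
    n3str n x y = (x ⟨0, by omega⟩ * y ⟨1, by omega⟩ - x ⟨1, by omega⟩ * y ⟨0, by omega⟩) •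
      Pi.single ⟨2, by omega⟩ 1 := by
  let p : Fin n → Fin n → (Fin n → k) →ₗ[k] (Fin n → k) →ₗ[k] k := fun i j =>
    (LinearMap.mul k k).compl₁₂ (LinearMap.proj i) (LinearMap.proj j)
  have : n3str n = formStr (p ⟨0, by omega⟩ ⟨1, by omega⟩ - p ⟨1, by omega⟩ ⟨0, by omega⟩)
      (Pi.single ⟨2, by omega⟩ 1) := by
    refine structConst_injective (funext fun ⟨i, j, m⟩ => ?_)
    rw [n3str, structConst_ofConst]
    simp only [structConst, formStr_apply, p, LinearMap.sub_apply,
      LinearMap.compl₁₂_apply, LinearMap.proj_apply, LinearMap.mul_apply', Pi.single_apply,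
      Pi.smul_apply, smul_eq_mul, Fin.ext_iff]
    grind
  rw [this]
  simp [p]

/-- The two-sided kernel of a bilinear form. -/
def formKer (b : (Fin n → k) →ₗ[k] (Fin n → k) →ₗ[k] k) : Submodule k (Fin n → k) :=
  LinearMap.ker b ⊓ LinearMap.ker b.flip

theorem mem_formKer {b : (Fin n → k) →ₗ[k] (Fin n → k) →ₗ[k] k} {x : Fin n → k} :
    x ∈ formKer b ↔ (∀ y, b x y = 0) ∧ ∀ y, b y x = 0 := by
  simp [formKer, LinearMap.ext_iff]

theorem repr_formStr (hn : 3 ≤ n) {b : (Fin n → k) →ₗ[k] (Fin n → k) →ₗ[k] k} {v : Fin n → k}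
    (β : Module.Basis (Fin n) k (Fin n → k)) (h2 : β ⟨2, by omega⟩ = v) (i j m : Fin n) :
    β.repr (formStr b v (β i) (β j)) m = if (m : ℕ) = 2 then b (β i) (β j) else 0 := by
  rw [formStr_apply, map_smul, ← h2, Module.Basis.repr_self, Finsupp.smul_apply,
    Finsupp.single_apply]
  simp [Fin.ext_iff, eq_comm]

theorem formStr_mem_orbit_FabStr (hn : 3 ≤ n) {b : (Fin n → k) →ₗ[k] (Fin n → k) →ₗ[k] k}
    {e u v : Fin n → k} (hv : v ≠ 0) (hvK : v ∈ formKer b) (hee : b e e = 1) (huu : b u u = 0)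
    (hαβ : ¬ (b e u = 0 ∧ b u e = 0))
    (hK : ∀ x, ∃ s t : k, x - (s • e + t • u) ∈ formKer b) :
    formStr b v ∈ orbit (FabStr n (b e u) (b u e)) := by
  obtain ⟨hv1, hv2⟩ := mem_formKer.1 hvK
  obtain ⟨β, h0, h1, h2, h3⟩ := exists_basis_extend_triple hn e u v (fun r s t h => by
    have H1 := congrArg (b e) h
    have H2 := congrArg (b u) h
    have H3 := congrArg (fun x => b x e) h
    have H4 := congrArg (fun x => b x u) h
    simp only [map_add, map_smul, LinearMap.add_apply, LinearMap.smul_apply, smul_eq_mul, hee, huu,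
      hv1, hv2, map_zero, LinearMap.zero_apply] at H1 H2 H3 H4
    have hr : r = 0 := by grind
    have hs : s = 0 := by grind
    subst hr hs
    simpa [hv] using h) (formKer b) (fun x => by
    obtain ⟨s, t, h⟩ := hK x
    exact ⟨s, t, 0, by simpa using h⟩)
  refine mem_orbit_ofConst β _ _ fun i j m => ?_
  have hker : ∀ i : Fin n, 2 ≤ (i : ℕ) → β i ∈ formKer b := fun i hi => by
    rcases hi.eq_or_lt with h | h
    · rw [show i = ⟨2, by omega⟩ from Fin.ext h.symm, h2]
      exact hvK
    · exact h3 i h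
  rw [repr_formStr hn β h2]
  obtain hi | hi | hi : i = ⟨0, by omega⟩ ∨ i = ⟨1, by omega⟩ ∨ 2 ≤ (i : ℕ) := by
    simp only [Fin.ext_iff]; omega
  · obtain hj | hj | hj : j = ⟨0, by omega⟩ ∨ j = ⟨1, by omega⟩ ∨ 2 ≤ (j : ℕ) := by
      simp only [Fin.ext_iff]; omega
    · subst hi hj; simp [h0, hee]
    · subst hi hj; simp [h0, h1]
    · rw [(mem_formKer.1 (hker j hj)).2]
      grind
  · obtain hj | hj | hj : j = ⟨0, by omega⟩ ∨ j = ⟨1, by omega⟩ ∨ 2 ≤ (j : ℕ) := by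
      simp only [Fin.ext_iff]; omega
    · subst hi hj; simp [h0, h1]
    · subst hi hj; simp [h1, huu]
    · rw [(mem_formKer.1 (hker j hj)).2]
      grind
  · rw [(mem_formKer.1 (hker i hi)).1]
    grind

theorem formStr_mem_orbit_n3str (hn : 3 ≤ n) {b : (Fin n → k) →ₗ[k] (Fin n → k) →ₗ[k] k}
    {e u v : Fin n → k} (hv : v ≠ 0) (hvK : v ∈ formKer b) (halt : ∀ x, b x x = 0)
    (heu : b e u = 1) (hK : ∀ x, ∃ s t : k, x - (s • e + t • u) ∈ formKer b) :
    formStr b v ∈ orbit (n3str n) := by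
  obtain ⟨hv1, hv2⟩ := mem_formKer.1 hvK
  have hue : b u e = -1 := by
    have := halt (e + u)
    simp only [map_add, LinearMap.add_apply, halt, heu] at this
    linear_combination this
  obtain ⟨β, h0, h1, h2, h3⟩ := exists_basis_extend_triple hn e u v (fun r s t h => by
    have H1 := congrArg (b e) h
    have H2 := congrArg (b u) h
    simp only [map_add, map_smul, smul_eq_mul, halt, heu, hue, hv2, map_zero] at H1 H2
    have hr : r = 0 := by grind
    have hs : s = 0 := by grind
    subst hr hs
    simpa [hv] using h) (formKer b) (fun x => by
    obtain ⟨s, t, h⟩ := hK x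
    exact ⟨s, t, 0, by simpa using h⟩)
  refine mem_orbit_ofConst β _ _ fun i j m => ?_
  have hker : ∀ i : Fin n, 2 ≤ (i : ℕ) → β i ∈ formKer b := fun i hi => by
    rcases hi.eq_or_lt with h | h
    · rw [show i = ⟨2, by omega⟩ from Fin.ext h.symm, h2]
      exact hvK
    · exact h3 i h
  rw [repr_formStr hn β h2]
  obtain hi | hi | hi : i = ⟨0, by omega⟩ ∨ i = ⟨1, by omega⟩ ∨ 2 ≤ (i : ℕ) := by
    simp only [Fin.ext_iff]; omega
  · obtain hj | hj | hj : j = ⟨0, by omega⟩ ∨ j = ⟨1, by omega⟩ ∨ 2 ≤ (j : ℕ) := by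
      simp only [Fin.ext_iff]; omega
    · subst hi hj; simp [halt]
    · subst hi hj; simp [h0, h1, heu]
    · rw [(mem_formKer.1 (hker j hj)).2]
      grind
  · obtain hj | hj | hj : j = ⟨0, by omega⟩ ∨ j = ⟨1, by omega⟩ ∨ 2 ≤ (j : ℕ) := by
      simp only [Fin.ext_iff]; omega
    · subst hi hj; simp [h0, h1, hue]
    · subst hi hj; simp [halt]
    · rw [(mem_formKer.1 (hker j hj)).2]
      grind
  · rw [(mem_formKer.1 (hker i hi)).1]
    grind

theorem mem_orbit_FabStr_zero_zero (hn : 3 ≤ n) {μ : AlgStr k n} {l : (Fin n → k) →ₗ[k] k}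
    {e v : Fin n → k} (hv : v ≠ 0) (hlv : l v = 0) (hle : l e = 1)
    (hμ : ∀ x y, μ x y = (l x * l y) • v) : μ ∈ orbit (FabStr n (0 : k) 0) := by
  let f : Fin n → Fin n → k := fun i => if (i : ℕ) = 0 then e else v
  let s : Finset (Fin n) := {⟨0, by omega⟩, ⟨2, by omega⟩}
  obtain ⟨β, hβ, hβ'⟩ := exists_basis_extend s f (by
    rw [linearIndepOn_finset_iff]
    intro g hg
    simp only [s, f] at hg
    rw [Finset.sum_insert (by simp), Finset.sum_singleton] at hg
    have h0 := congrArg l hg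
    have : g ⟨0, by omega⟩ = 0 := by simpa [hle, hlv] using h0
    simpa [s, this, hv] using hg) (LinearMap.ker l) (by
    rw [eq_top_iff]
    rintro x -
    refine Submodule.mem_sup.2 ⟨l x • e, Submodule.smul_mem _ _
      (Submodule.subset_span ⟨⟨0, by omega⟩, by simp [s], by simp [f]⟩), x - l x • e, ?_, by abel⟩
    simp [hle])
  have h0 : β ⟨0, by omega⟩ = e := by simpa [f] using hβ ⟨0, by omega⟩ (by simp [s])
  have h2 : β ⟨2, by omega⟩ = v := by simpa [f] using hβ ⟨2, by omega⟩ (by simp [s])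
  have hl : ∀ i, l (β i) = if (i : ℕ) = 0 then 1 else 0 := fun i => by
    split_ifs with hi
    · rw [show i = ⟨0, by omega⟩ from Fin.ext hi, h0, hle]
    · by_cases hi2 : (i : ℕ) = 2
      · rw [show i = ⟨2, by omega⟩ from Fin.ext hi2, h2, hlv]
      · exact hβ' i (by simp [s, Fin.ext_iff, hi, hi2])
  refine mem_orbit_ofConst β _ _ fun i j m => ?_
  rw [hμ, map_smul, ← h2, Module.Basis.repr_self, Finsupp.smul_apply, Finsupp.single_apply, hl, hl]
  simp only [Fin.ext_iff, smul_eq_mul]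
  grind

/-- Structures whose product is `b(x, y) v` with `b` pulled back from a plane along a map
killing `v`. -/
def IsTwoForm (μ : AlgStr k n) : Prop :=
  ∃ (ξ η : (Fin n → k) →ₗ[k] k) (v : Fin n → k) (a b c d : k), ξ v = 0 ∧ η v = 0 ∧
    ∀ x y, μ x y = (a * ξ x * ξ y + b * ξ x * η y + c * η x * ξ y + d * η x * η y) • v

theorem isTwoForm_FabStr (hn : 3 ≤ n) (α β : k) : IsTwoForm (FabStr n α β) := by
  refine ⟨LinearMap.proj ⟨0, by omega⟩, LinearMap.proj ⟨1, by omega⟩, Pi.single ⟨2, by omega⟩ 1,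
    1, α, β, 0, ?_, ?_, fun x y => ?_⟩
  · simp
  · simp
  · rw [FabStr_apply hn]
    simp only [LinearMap.proj_apply]
    congr 1
    ring

theorem isTwoForm_n3str (hn : 3 ≤ n) : IsTwoForm (n3str n : AlgStr k n) := by
  refine ⟨LinearMap.proj ⟨0, by omega⟩, LinearMap.proj ⟨1, by omega⟩, Pi.single ⟨2, by omega⟩ 1,
    0, 1, -1, 0, ?_, ?_, fun x y => ?_⟩
  · simp
  · simp
  · rw [n3str_apply hn]
    simp only [LinearMap.proj_apply]
    congr 1
    ring

theorem IsTwoForm.of_mem_orbit {μ ν : AlgStr k n} (h : IsTwoForm μ) (hν : ν ∈ orbit μ) :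
    IsTwoForm ν := by
  obtain ⟨g, rfl⟩ := hν
  obtain ⟨ξ, η, v, a, b, c, d, hξ, hη, hμ⟩ := h
  exact ⟨ξ ∘ₗ g.symm, η ∘ₗ g.symm, g v, a, b, c, d, by simpa, by simpa, fun x y => by
    simp [transport_apply, hμ]⟩

end TwoForms
section Degenerations

variable {n : ℕ}

theorem degenerates_FabStr_zero_zero [Infinite k] (α β : k) :
    degenerates (FabStr n α β) (FabStr n (0 : k) 0) := by
  have h := degenerates_of_weights (FabStr n α β) (fun i => if (i : ℕ) = 0 then 1 else 2)
    (fun i j m => by split_ifs <;> omega)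
  convert h using 1
  refine structConst_injective (funext fun ⟨i, j, m⟩ => ?_)
  simp only [structConst_ofConst, FabStr]
  grind

theorem degenerates_FabStr [Infinite k] (hn : 3 ≤ n) (μ : AlgStr k n) (φ : (Fin n → k) →ₗ[k] k)
    {e u : Fin n → k} (he : φ e = 0) (hu : φ u = 0) (hee : φ (μ e e) = 1) (huu : φ (μ u u) = 0)
    (hαβ : ¬ (φ (μ e u) = 0 ∧ φ (μ u e) = 0)) :
    degenerates μ (FabStr n (φ (μ e u)) (φ (μ u e))) := by
  obtain ⟨γ, h0, h1, h2, h3⟩ := exists_basis_extend_triple hn e u (μ e e) (fun r s t h => by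
    have ht : t = 0 := by simpa [he, hu, hee] using congrArg φ h
    subst ht
    have H1 := congrArg (fun x => φ (μ e x)) h
    have H2 := congrArg (fun x => φ (μ u x)) h
    have H3 := congrArg (fun x => φ (μ x e)) h
    have H4 := congrArg (fun x => φ (μ x u)) h
    simp only [map_add, map_smul, LinearMap.add_apply, LinearMap.smul_apply, smul_eq_mul, hee, huu,
      zero_smul, map_zero, LinearMap.zero_apply] at H1 H2 H3 H4
    have hr : r = 0 := by grind
    have hs : s = 0 := by grind
    exact ⟨hr, hs, rfl⟩) (LinearMap.ker φ) (fun x => ⟨0, 0, φ x, by simp [hee]⟩)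
  have hφ : ∀ x, γ.repr x ⟨2, by omega⟩ = φ x := by
    have : γ.coord ⟨2, by omega⟩ = φ := γ.ext fun i => by
      rw [Module.Basis.coord_apply, Module.Basis.repr_self, Finsupp.single_apply]
      obtain hi | hi | hi | hi : i = ⟨0, by omega⟩ ∨ i = ⟨1, by omega⟩ ∨ i = ⟨2, by omega⟩ ∨
          3 ≤ (i : ℕ) := by
        simp only [Fin.ext_iff]; omega
      · subst hi; simp [h0, he]
      · subst hi; simp [h1, hu]
      · subst hi; simp [h2, hee]
      · rw [LinearMap.mem_ker.1 (h3 i hi), if_neg]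
        simp only [Fin.ext_iff]
        omega
    exact fun x => LinearMap.congr_fun this x
  rw [← degenerates_congr_left (μ' := transport γ.equivFun μ) ⟨γ.equivFun, rfl⟩]
  have h := degenerates_of_weights (transport γ.equivFun μ)
    (fun i => if (i : ℕ) < 2 then 2 else if (i : ℕ) = 2 then 4 else 3)
    (fun i j m => by split_ifs <;> omega)
  convert h using 1
  refine structConst_injective (funext fun ⟨i, j, m⟩ => ?_)
  simp only [structConst_ofConst, FabStr]
  have hsc : structConst (transport γ.equivFun μ) (i, j, m) = γ.repr (μ (γ i) (γ j)) m := by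
    simp [structConst, transport_apply]
  rw [hsc]
  by_cases hm : m = ⟨2, by omega⟩
  · obtain hi | hi | hi : i = ⟨0, by omega⟩ ∨ i = ⟨1, by omega⟩ ∨ 2 ≤ (i : ℕ) := by
      simp only [Fin.ext_iff]; omega
    · obtain hj | hj | hj : j = ⟨0, by omega⟩ ∨ j = ⟨1, by omega⟩ ∨ 2 ≤ (j : ℕ) := by
        simp only [Fin.ext_iff]; omega
      · subst hi hj hm; simp [hφ, h0, hee]
      · subst hi hj hm; simp [hφ, h0, h1]
      · subst hi hm
        grind
    · obtain hj | hj | hj : j = ⟨0, by omega⟩ ∨ j = ⟨1, by omega⟩ ∨ 2 ≤ (j : ℕ) := by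
        simp only [Fin.ext_iff]; omega
      · subst hi hj hm; simp [hφ, h0, h1]
      · subst hi hj hm; simp [hφ, h1, huu]
      · subst hi hm
        grind
    · subst hm
      grind
  · have hm' : (m : ℕ) ≠ 2 := fun h => hm (Fin.ext h)
    grind

theorem degenerates.mul_apply_comm {μ χ : AlgStr k n} (h : degenerates μ χ) (hμ : IsTwoForm μ)
    (x y z w : Fin n → k) (i j : Fin n) : χ x y i * χ z w j = χ x y j * χ z w i := by
  refine sub_eq_zero.1 (h.eq_zero_of_isPolyFun (F := fun χ => χ x y i * χ z w j - χ x y j * χ z w i)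
    (.sub (.mul (.apply _ _ _) (.apply _ _ _)) (.mul (.apply _ _ _) (.apply _ _ _)))
    fun ν hν => ?_)
  obtain ⟨ξ, η, v, a, b, c, d, hξ, hη, H⟩ := hμ.of_mem_orbit hν
  simp only [H, Pi.smul_apply, smul_eq_mul]
  ring

theorem degenerates.apply_apply_left {μ χ : AlgStr k n} (h : degenerates μ χ) (hμ : IsTwoForm μ)
    (x y z : Fin n → k) : χ (χ x y) z = 0 := by
  funext i
  refine h.eq_zero_of_isPolyFun (.apply_apply_left x y z i) fun ν hν => ?_
  obtain ⟨ξ, η, v, a, b, c, d, hξ, hη, H⟩ := hμ.of_mem_orbit hν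
  simp [H, hξ, hη]

theorem degenerates.apply_apply_right {μ χ : AlgStr k n} (h : degenerates μ χ) (hμ : IsTwoForm μ)
    (x y z : Fin n → k) : χ z (χ x y) = 0 := by
  funext i
  refine h.eq_zero_of_isPolyFun (.apply_apply_right x y z i) fun ν hν => ?_
  obtain ⟨ξ, η, v, a, b, c, d, hξ, hη, H⟩ := hμ.of_mem_orbit hν
  simp [H, hξ, hη]

/-- The multiplication by `y` on the right or on the left. -/
def sideMul (χ : AlgStr k n) (s : Bool) (y x : Fin n → k) : Fin n → k :=
  if s then χ y x else χ x y

theorem degenerates.sideMul_det {μ χ : AlgStr k n} (h : degenerates μ χ) (hμ : IsTwoForm μ)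
    (s₁ s₂ s₃ : Bool) (y₁ y₂ y₃ x₁ x₂ x₃ : Fin n → k) (i : Fin n) :
    sideMul χ s₁ y₁ x₁ i * (sideMul χ s₂ y₂ x₂ i * sideMul χ s₃ y₃ x₃ i -
        sideMul χ s₂ y₂ x₃ i * sideMul χ s₃ y₃ x₂ i) -
      sideMul χ s₁ y₁ x₂ i * (sideMul χ s₂ y₂ x₁ i * sideMul χ s₃ y₃ x₃ i -
        sideMul χ s₂ y₂ x₃ i * sideMul χ s₃ y₃ x₁ i) +
      sideMul χ s₁ y₁ x₃ i * (sideMul χ s₂ y₂ x₁ i * sideMul χ s₃ y₃ x₂ i -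
        sideMul χ s₂ y₂ x₂ i * sideMul χ s₃ y₃ x₁ i) = 0 := by
  have hp : ∀ s (y x : Fin n → k), IsPolyFun (fun χ : AlgStr k n => sideMul χ s y x i) := by
    rintro (_ | _) y x <;> exact .apply _ _ _
  refine h.eq_zero_of_isPolyFun (F := fun χ =>
    sideMul χ s₁ y₁ x₁ i * (sideMul χ s₂ y₂ x₂ i * sideMul χ s₃ y₃ x₃ i -
        sideMul χ s₂ y₂ x₃ i * sideMul χ s₃ y₃ x₂ i) -
      sideMul χ s₁ y₁ x₂ i * (sideMul χ s₂ y₂ x₁ i * sideMul χ s₃ y₃ x₃ i -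
        sideMul χ s₂ y₂ x₃ i * sideMul χ s₃ y₃ x₁ i) +
      sideMul χ s₁ y₁ x₃ i * (sideMul χ s₂ y₂ x₁ i * sideMul χ s₃ y₃ x₂ i -
        sideMul χ s₂ y₂ x₂ i * sideMul χ s₃ y₃ x₁ i))
    (.add (.sub (.mul (hp _ _ _) (.sub (.mul (hp _ _ _) (hp _ _ _)) (.mul (hp _ _ _) (hp _ _ _))))
      (.mul (hp _ _ _) (.sub (.mul (hp _ _ _) (hp _ _ _)) (.mul (hp _ _ _) (hp _ _ _)))))
      (.mul (hp _ _ _) (.sub (.mul (hp _ _ _) (hp _ _ _)) (.mul (hp _ _ _) (hp _ _ _)))))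
    fun ν hν => ?_
  obtain ⟨ξ, η, v, a, b, c, d, hξ, hη, H⟩ := hμ.of_mem_orbit hν
  have hs : ∀ s y, ∃ p q, ∀ x, sideMul ν s y x i = p * ξ x + q * η x := by
    rintro (_ | _) y
    · exact ⟨(a * ξ y + b * η y) * v i, (c * ξ y + d * η y) * v i, fun x => by
        simp only [sideMul, H, Pi.smul_apply, smul_eq_mul, Bool.false_eq_true, if_false]; ring⟩
    · exact ⟨(a * ξ y + c * η y) * v i, (b * ξ y + d * η y) * v i, fun x => by
        simp only [sideMul, H, Pi.smul_apply, smul_eq_mul, if_true]; ring⟩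
  obtain ⟨p₁, q₁, h₁⟩ := hs s₁ y₁
  obtain ⟨p₂, q₂, h₂⟩ := hs s₂ y₂
  obtain ⟨p₃, q₃, h₃⟩ := hs s₃ y₃
  simp only [h₁, h₂, h₃]
  ring

/-- A degeneration of a structure of two-form type is zero or one of the listed forms. -/
theorem degenerates.eq_zero_or_mem_orbit [IsAlgClosed k] (hn : 3 ≤ n) {μ χ : AlgStr k n}
    (h : degenerates μ χ) (hμ : IsTwoForm μ) :
    χ = 0 ∨ χ ∈ orbit (n3str n) ∨ ∃ α β : k, χ ∈ orbit (FabStr n α β) := by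
  by_cases hχ : χ = 0
  · exact .inl hχ
  refine .inr ?_
  obtain ⟨x₀, y₀, i₀, h₀⟩ : ∃ x y i, χ x y i ≠ 0 := by
    by_contra! hcon
    exact hχ (LinearMap.ext fun x => LinearMap.ext fun y => funext fun i => hcon x y i)
  obtain ⟨b, hb⟩ : ∃ b : (Fin n → k) →ₗ[k] (Fin n → k) →ₗ[k] k, ∀ x y, b x y = χ x y i₀ :=
    ⟨χ.compr₂ (LinearMap.proj i₀), fun _ _ => rfl⟩
  obtain ⟨v, hv⟩ : ∃ v, v = (χ x₀ y₀ i₀)⁻¹ • χ x₀ y₀ := ⟨_, rfl⟩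
  have hv0 : v ≠ 0 := by
    rw [hv]
    exact smul_ne_zero (inv_ne_zero h₀) fun h => h₀ (by rw [h]; rfl)
  have hvK : v ∈ formKer b := by
    rw [mem_formKer]
    simp [hb, hv, h.apply_apply_left hμ, h.apply_apply_right hμ]
  have hform : χ = formStr b v := by
    refine LinearMap.ext fun x => LinearMap.ext fun y => funext fun j => ?_
    simp only [formStr_apply, hb, hv, Pi.smul_apply, smul_eq_mul]
    field_simp
    exact h.mul_apply_comm hμ _ _ _ _ _ _
  have hminor : ∀ (s₁ s₂ : Bool) (y₁ y₂ e u : Fin n → k),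
      sideMul χ s₁ y₁ e i₀ * sideMul χ s₂ y₂ u i₀ - sideMul χ s₁ y₁ u i₀ * sideMul χ s₂ y₂ e i₀ ≠ 0 →
      ∀ x, ∃ s t : k, x - (s • e + t • u) ∈ formKer b := by
    intro s₁ s₂ y₁ y₂ e u hD x
    set D := sideMul χ s₁ y₁ e i₀ * sideMul χ s₂ y₂ u i₀ -
      sideMul χ s₁ y₁ u i₀ * sideMul χ s₂ y₂ e i₀ with hDdef
    obtain ⟨s, hs⟩ : ∃ s, s = D⁻¹ * (sideMul χ s₁ y₁ x i₀ * sideMul χ s₂ y₂ u i₀ -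
      sideMul χ s₁ y₁ u i₀ * sideMul χ s₂ y₂ x i₀) := ⟨_, rfl⟩
    obtain ⟨t, ht⟩ : ∃ t, t = D⁻¹ * (sideMul χ s₁ y₁ e i₀ * sideMul χ s₂ y₂ x i₀ -
      sideMul χ s₁ y₁ x i₀ * sideMul χ s₂ y₂ e i₀) := ⟨_, rfl⟩
    have hlin : ∀ (r : Bool) y, sideMul χ r y (x - (s • e + t • u)) i₀ =
        sideMul χ r y x i₀ - (s * sideMul χ r y e i₀ + t * sideMul χ r y u i₀) := by
      rintro (_ | _) y <;> simp [sideMul]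
    have hvan : ∀ (r : Bool) y, sideMul χ r y (x - (s • e + t • u)) i₀ = 0 := fun r y => by
      have h3 := h.sideMul_det hμ s₁ s₂ r y₁ y₂ y e u x i₀
      rw [hlin, hs, ht]
      field_simp
      linear_combination h3
    refine ⟨s, t, mem_formKer.2 ⟨fun y => ?_, fun y => ?_⟩⟩
    · rw [hb]
      exact hvan false y
    · rw [hb]
      exact hvan true y
  rcases bilinForm_trichotomy b with halt | ⟨e, he, hsym, hsq⟩ | ⟨e, u, hee, huu, hαβ⟩
  · have hne := h₀
    rw [← hb] at hne
    obtain ⟨u, hu⟩ : ∃ u, b x₀ u = 1 := ⟨(b x₀ y₀)⁻¹ • y₀, by simp [hne]⟩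
    refine .inl (hform ▸ formStr_mem_orbit_n3str hn hv0 hvK halt hu
      (hminor true true x₀ u x₀ u ?_))
    have := halt (x₀ + u)
    simp only [map_add, LinearMap.add_apply, halt, hu] at this
    simp only [sideMul, if_true, ← hb, halt, hu]
    rw [show b u x₀ = -1 by linear_combination this]
    simp
  · refine .inr ⟨0, 0, mem_orbit_FabStr_zero_zero hn hv0 ((mem_formKer.1 hvK).2 e) he
      fun x y => ?_⟩
    rw [hform, formStr_apply, hsq]
  · refine .inr ⟨b e u, b u e, hform ▸ formStr_mem_orbit_FabStr hn hv0 hvK hee huu hαβ ?_⟩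
    by_cases heq : b e u = b u e
    · refine hminor true true e u e u ?_
      simp only [sideMul, if_true, ← hb, hee, huu, heq]
      simp only [heq, and_self] at hαβ
      simpa using hαβ
    · refine hminor true false e e e u ?_
      simp only [sideMul, if_true, ← hb, hee, Bool.false_eq_true, if_false]
      intro h0
      exact heq (by linear_combination -h0)

end Degenerations
section Level

variable {n : ℕ}

theorem exists_linearEquiv_add_smul (ψ : (Fin n → k) →ₗ[k] k) (e : Fin n → k) (h : 1 + ψ e ≠ 0) :
    ∃ g : (Fin n → k) ≃ₗ[k] (Fin n → k), ∀ x, g x = x + ψ x • e := by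
  let f : (Fin n → k) →ₗ[k] (Fin n → k) := LinearMap.id + ψ.smulRight e
  have hf : ∀ x, f x = x + ψ x • e := fun x => rfl
  refine ⟨LinearEquiv.ofInjectiveEndo f ((injective_iff_map_eq_zero f).2 fun x hx => ?_), hf⟩
  rw [hf] at hx
  have hψ : ψ x * (1 + ψ e) = 0 := by
    have := congrArg ψ hx
    simp only [map_add, map_smul, smul_eq_mul, map_zero] at this
    linear_combination this
  rw [(mul_eq_zero.1 hψ).resolve_right h] at hx
  simpa using hx

theorem FabStr_smul_mem_orbit (hn : 3 ≤ n) (α β : k) {s : k} (hs : s ≠ 0) :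
    FabStr n (s * α) (s * β) ∈ orbit (FabStr n α β) := by
  obtain ⟨g, hg⟩ := exists_linearEquiv_add_smul ((s⁻¹ - 1) • LinearMap.proj ⟨1, by omega⟩)
    (Pi.single (⟨1, by omega⟩ : Fin n) (1 : k)) (by simpa using hs)
  refine mem_orbit_iff.2 ⟨g, fun x y => ?_⟩
  simp only [FabStr_apply hn, map_smul, hg]
  simp only [LinearMap.smul_apply, LinearMap.proj_apply, Pi.add_apply, Pi.smul_apply, Pi.single_apply,
    Fin.ext_iff, smul_eq_mul]
  norm_num
  field_simp
  ring

theorem FabStr_swap_mem_orbit (hn : 3 ≤ n) (α β : k) :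
    FabStr n α β ∈ orbit (FabStr n β α) := by
  obtain ⟨g, hg⟩ := exists_linearEquiv_add_smul (LinearMap.proj (⟨1, by omega⟩ : Fin n))
    ((Pi.single (⟨0, by omega⟩ : Fin n) (α + β) : Fin n → k) - Pi.single ⟨1, by omega⟩ (2 : k)) (by
    norm_num [Pi.single_apply])
  refine mem_orbit_iff.2 ⟨g, fun x y => ?_⟩
  simp only [FabStr_apply hn, map_smul, hg]
  simp only [LinearMap.proj_apply, Pi.add_apply, Pi.smul_apply, Pi.single_apply, Pi.sub_apply,
    Fin.ext_iff, smul_eq_mul]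
  norm_num
  ring

theorem exists_apply_eq_of_mem_orbit_FabStr (hn : 3 ≤ n) {α β : k} {χ : AlgStr k n}
    (h : χ ∈ orbit (FabStr n α β)) : ∃ x y i, ∃ c : k, c ≠ 0 ∧ χ x x i = c ∧ χ x y i = α * c ∧
      χ y x i = β * c ∧ χ y y i = 0 := by
  obtain ⟨g, hg⟩ := mem_orbit_iff.1 h
  have hv : g (Pi.single ⟨2, by omega⟩ 1) ≠ 0 := by simp
  obtain ⟨i, hi⟩ := Function.ne_iff.1 hv
  refine ⟨g (Pi.single ⟨0, by omega⟩ 1), g (Pi.single ⟨1, by omega⟩ 1), i, _, hi, ?_, ?_, ?_, ?_⟩ <;>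
  simp [hg, FabStr_apply hn]

theorem exists_apply_eq_of_mem_orbit_n3str (hn : 3 ≤ n) {χ : AlgStr k n}
    (h : χ ∈ orbit (n3str n)) : ∃ x y i, ∃ c : k, c ≠ 0 ∧ χ x x i = 0 ∧ χ x y i = c ∧
      χ y x i = -c := by
  obtain ⟨g, hg⟩ := mem_orbit_iff.1 h
  have hv : g (Pi.single ⟨2, by omega⟩ 1) ≠ 0 := by simp
  obtain ⟨i, hi⟩ := Function.ne_iff.1 hv
  refine ⟨g (Pi.single ⟨0, by omega⟩ 1), g (Pi.single ⟨1, by omega⟩ 1), i, _, hi, ?_, ?_, ?_⟩ <;>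
  simp [hg, n3str_apply hn]

theorem apply_of_mem_orbit_FabStr (hn : 3 ≤ n) {α β : k} {ν : AlgStr k n}
    (h : ν ∈ orbit (FabStr n α β)) : ∃ (ξ η : (Fin n → k) → k) (v : Fin n → k),
      ∀ x y i, ν x y i = (ξ x * ξ y + α * (ξ x * η y) + β * (η x * ξ y)) * v i := by
  obtain ⟨g, rfl⟩ := h
  refine ⟨fun x => g.symm x ⟨0, by omega⟩, fun x => g.symm x ⟨1, by omega⟩,
    g (Pi.single ⟨2, by omega⟩ 1), fun x y i => ?_⟩
  simp [transport_apply, FabStr_apply hn]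

theorem degenerates.FabStr_quadric (hn : 3 ≤ n) {α β : k} {χ : AlgStr k n}
    (h : degenerates (FabStr n α β) χ) (x y : Fin n → k) (i : Fin n) :
    (α - β) * (α - β) * (χ x x i * χ y y i - χ x y i * χ y x i) +
      α * β * ((χ x y i - χ y x i) * (χ x y i - χ y x i)) = 0 := by
  refine h.eq_zero_of_isPolyFun (F := fun χ => (α - β) * (α - β) * (χ x x i * χ y y i -
      χ x y i * χ y x i) + α * β * ((χ x y i - χ y x i) * (χ x y i - χ y x i)))
    (.add (.mul (.const _) (.sub (.mul (.apply _ _ _) (.apply _ _ _))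
      (.mul (.apply _ _ _) (.apply _ _ _)))) (.mul (.const _)
      (.mul (.sub (.apply _ _ _) (.apply _ _ _)) (.sub (.apply _ _ _) (.apply _ _ _)))))
    fun ν hν => ?_
  obtain ⟨ξ, η, v, H⟩ := apply_of_mem_orbit_FabStr hn hν
  simp only [H]
  ring

theorem degenerates.FabStr_zero_zero_comm (hn : 3 ≤ n) {χ : AlgStr k n}
    (h : degenerates (FabStr n (0 : k) 0) χ) (x y : Fin n → k) (i : Fin n) :
    χ x y i = χ y x i := by
  refine sub_eq_zero.1 (h.eq_zero_of_isPolyFun (F := fun χ => χ x y i - χ y x i)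
    (.sub (.apply _ _ _) (.apply _ _ _)) fun ν hν => ?_)
  obtain ⟨ξ, η, v, H⟩ := apply_of_mem_orbit_FabStr hn hν
  simp only [H]
  ring

theorem degenerates.FabStr_zero_zero_det (hn : 3 ≤ n) {χ : AlgStr k n}
    (h : degenerates (FabStr n (0 : k) 0) χ) (x y : Fin n → k) (i : Fin n) :
    χ x x i * χ y y i - χ x y i * χ y x i = 0 := by
  refine h.eq_zero_of_isPolyFun (F := fun χ => χ x x i * χ y y i - χ x y i * χ y x i)
    (.sub (.mul (.apply _ _ _) (.apply _ _ _)) (.mul (.apply _ _ _) (.apply _ _ _))) fun ν hν => ?_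
  obtain ⟨ξ, η, v, H⟩ := apply_of_mem_orbit_FabStr hn hν
  simp only [H]
  ring

theorem degenerates.n3str_self (hn : 3 ≤ n) {χ : AlgStr k n}
    (h : degenerates (n3str n) χ) (x : Fin n → k) (i : Fin n) : χ x x i = 0 := by
  refine h.eq_zero_of_isPolyFun (.apply _ _ _) fun ν hν => ?_
  obtain ⟨g, rfl⟩ := hν
  simp [transport_apply, n3str_apply hn, mul_comm]

theorem degenerates.eq_zero_of_zero {χ : AlgStr k n} (h : degenerates 0 χ) : χ = 0 := by
  refine LinearMap.ext fun x => LinearMap.ext fun y => funext fun i => ?_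
  refine h.eq_zero_of_isPolyFun (.apply x y i) fun ν hν => ?_
  rw [eq_zero_of_mem_orbit_zero hν]
  rfl

theorem not_hasChain_zero_one : ¬ hasChain (0 : AlgStr k n) 1 := by
  rw [hasChain_succ]
  rintro ⟨χ, hχ, -⟩
  have h0 := hχ.1.eq_zero_of_zero
  subst h0
  exact hχ.2 (mem_orbit_self 0)

theorem eq_zero_of_mem_orbit_FabStr_of_degenerates (hn : 3 ≤ n) {α β : k} {χ : AlgStr k n}
    (h : degenerates (FabStr n 0 0) χ) (hχ : χ ∈ orbit (FabStr n α β)) : α = 0 ∧ β = 0 := by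
  obtain ⟨x, y, i, c, hc, hxx, hxy, hyx, hyy⟩ := exists_apply_eq_of_mem_orbit_FabStr hn hχ
  have h1 := h.FabStr_zero_zero_comm hn x y i
  have h2 := h.FabStr_zero_zero_det hn x y i
  rw [hxy, hyx] at h1
  rw [hxx, hyy, hxy, hyx] at h2
  have h3 := mul_right_cancel₀ hc h1
  subst h3
  simpa [hc] using h2

theorem degenerates.of_FabStr_zero_zero [IsAlgClosed k] (hn : 3 ≤ n) {χ : AlgStr k n}
    (h : degenerates (FabStr n (0 : k) 0) χ) : χ = 0 ∨ χ ∈ orbit (FabStr n (0 : k) 0) := by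
  rcases h.eq_zero_or_mem_orbit hn (isTwoForm_FabStr hn 0 0) with h0 | h3 | ⟨α, β, hF⟩
  · exact .inl h0
  · obtain ⟨x, y, i, c, hc, hxx, hxy, hyx⟩ := exists_apply_eq_of_mem_orbit_n3str hn h3
    have h2 := h.FabStr_zero_zero_det hn x y i
    rw [hxx, hxy, hyx] at h2
    simp [hc] at h2
  · obtain ⟨rfl, rfl⟩ := eq_zero_of_mem_orbit_FabStr_of_degenerates hn h hF
    exact .inr hF

theorem degenerates.of_n3str [IsAlgClosed k] (hn : 3 ≤ n) {χ : AlgStr k n}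
    (h : degenerates (n3str n) χ) : χ = 0 ∨ χ ∈ orbit (n3str n) := by
  rcases h.eq_zero_or_mem_orbit hn (isTwoForm_n3str hn) with h0 | h3 | ⟨α, β, hF⟩
  · exact .inl h0
  · exact .inr h3
  · obtain ⟨x, y, i, c, hc, hxx, -⟩ := exists_apply_eq_of_mem_orbit_FabStr hn hF
    exact absurd (hxx.symm.trans (h.n3str_self hn x i)) hc

theorem FabStr_mem_orbit_of_degenerates (hn : 3 ≤ n) {α β α' β' : k}
    (hαβ : (α, β) ≠ (0, 0)) (hαβ' : (α', β') ≠ (0, 0)) {χ : AlgStr k n}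
    (h : degenerates (FabStr n α β) χ) (hχ : χ ∈ orbit (FabStr n α' β')) :
    χ ∈ orbit (FabStr n α β) := by
  simp only [ne_eq, Prod.mk.injEq] at hαβ hαβ'
  have key : ∀ {α β : k}, ¬ (α = 0 ∧ β = 0) → β * α' = α * β' →
      FabStr n α' β' ∈ orbit (FabStr n α β) := by
    intro α β hne heq
    obtain ⟨s, hs, rfl, rfl⟩ : ∃ s, s ≠ 0 ∧ α' = s * α ∧ β' = s * β := by
      by_cases hα : α = 0
      · have hβ : β ≠ 0 := fun h => hne ⟨hα, h⟩
        have hα' : α' = 0 := by simpa [hα, hβ] using heq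
        refine ⟨β' / β, div_ne_zero (fun h => hαβ' ⟨hα', h⟩) hβ, by simp [hα, hα'], by field_simp⟩
      · refine ⟨α' / α, div_ne_zero (fun h => hαβ' ⟨h, ?_⟩) hα, by field_simp, by
          field_simp; linear_combination -heq⟩
        simpa [h, hα] using heq
    exact FabStr_smul_mem_orbit hn _ _ hs
  refine mem_orbit_trans ?_ hχ
  obtain ⟨x, y, i, c, hc, hxx, hxy, hyx, hyy⟩ := exists_apply_eq_of_mem_orbit_FabStr hn hχ
  have h1 := h.FabStr_quadric hn x y i
  rw [hxx, hyy, hxy, hyx] at h1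
  have h2 : (c * c) * ((α * α' - β * β') * (β * α' - α * β')) = 0 := by linear_combination h1
  rcases mul_eq_zero.1 ((mul_eq_zero.1 h2).resolve_left (mul_ne_zero hc hc)) with h3 | h3
  · exact mem_orbit_trans (FabStr_swap_mem_orbit hn β α)
      (key (fun h => hαβ ⟨h.2, h.1⟩) (sub_eq_zero.1 h3))
  · exact key hαβ (sub_eq_zero.1 h3)

theorem FabStr_zero_zero_ne_zero (hn : 3 ≤ n) : FabStr n (0 : k) 0 ≠ 0 := fun h => by
  obtain ⟨x, y, i, c, hc, hxx, -⟩ := exists_apply_eq_of_mem_orbit_FabStr hn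
    (mem_orbit_self (FabStr n (0 : k) 0))
  rw [h] at hxx
  exact hc hxx.symm

theorem degenerates_self (μ : AlgStr k n) : degenerates μ μ := fun _ _ h => h (mem_orbit_self μ)

theorem hasChain_two_FabStr [Infinite k] (hn : 3 ≤ n) {α β : k} (hαβ : (α, β) ≠ (0, 0)) :
    hasChain (FabStr n α β) 2 := by
  refine hasChain_succ.2 ⟨_, ⟨degenerates_FabStr_zero_zero α β, fun h => hαβ ?_⟩,
    hasChain_one (FabStr_zero_zero_ne_zero hn)⟩
  obtain ⟨rfl, rfl⟩ := eq_zero_of_mem_orbit_FabStr_of_degenerates hn (degenerates_self _)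
    (mem_orbit_trans h (mem_orbit_self _))
  rfl

theorem not_hasChain_two_FabStr_zero_zero [IsAlgClosed k] (hn : 3 ≤ n) :
    ¬ hasChain (FabStr n (0 : k) 0) 2 := by
  rw [hasChain_succ]
  rintro ⟨χ, hχ, hc⟩
  rcases hχ.1.of_FabStr_zero_zero hn with rfl | h
  · exact not_hasChain_zero_one hc
  · exact hχ.2 h

theorem not_hasChain_two_n3str [IsAlgClosed k] (hn : 3 ≤ n) :
    ¬ hasChain (n3str n : AlgStr k n) 2 := by
  rw [hasChain_succ]
  rintro ⟨χ, hχ, hc⟩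
  rcases hχ.1.of_n3str hn with rfl | h
  · exact not_hasChain_zero_one hc
  · exact hχ.2 h

theorem not_hasChain_three_FabStr [IsAlgClosed k] (hn : 3 ≤ n) {α β : k} (hαβ : (α, β) ≠ (0, 0)) :
    ¬ hasChain (FabStr n α β) 3 := by
  rw [hasChain_succ]
  rintro ⟨χ, hχ, hc⟩
  rcases hχ.1.eq_zero_or_mem_orbit hn (isTwoForm_FabStr hn α β) with rfl | h3 | ⟨α', β', hF⟩
  · obtain ⟨χ', hχ', -⟩ := hasChain_succ.1 hc
    have h0 := hχ'.1.eq_zero_of_zero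
    subst h0
    exact hχ'.2 (mem_orbit_self 0)
  · exact not_hasChain_two_n3str hn ((hasChain_congr h3 2).1 hc)
  · by_cases h0 : (α', β') = (0, 0)
    · obtain ⟨rfl, rfl⟩ := Prod.mk.inj h0
      exact not_hasChain_two_FabStr_zero_zero hn ((hasChain_congr hF 2).1 hc)
    · exact hχ.2 (FabStr_mem_orbit_of_degenerates hn hαβ h0 hχ.1 hF)

theorem levelIs_two_of_mem_orbit_FabStr [IsAlgClosed k] (hn : 3 ≤ n) {α β : k}
    (hαβ : (α, β) ≠ (0, 0)) {μ : AlgStr k n} (hμ : μ ∈ orbit (FabStr n α β)) : levelIs μ 2 := by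
  have : Infinite k := IsAlgClosed.instInfinite
  exact ⟨(hasChain_congr hμ 2).2 (hasChain_two_FabStr hn hαβ),
    fun h => not_hasChain_three_FabStr hn hαβ ((hasChain_congr hμ 3).1 h)⟩

end Level
section LinearStructures

variable {n : ℕ}

/-- The algebra structure `(x, y) ↦ p(y) x + p'(x) y + l(x) l(y) v`. -/
def linStr (p p' l : (Fin n → k) →ₗ[k] k) (v : Fin n → k) : AlgStr k n :=
  LinearMap.mk₂ k (fun x y => p y • x + p' x • y + (l x * l y) • v)
    (fun _ _ _ => by simp only [map_add]; module) (fun _ _ _ => by simp only [map_smul, smul_eq_mul]; module)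
    (fun _ _ _ => by simp only [map_add]; module) (fun _ _ _ => by simp only [map_smul, smul_eq_mul]; module)

@[simp]
theorem linStr_apply (p p' l : (Fin n → k) →ₗ[k] k) (v x y : Fin n → k) :
    linStr p p' l v x y = p y • x + p' x • y + (l x * l y) • v := rfl

theorem linStr_mem_orbit {p p' l q q' m : (Fin n → k) →ₗ[k] k} {v w : Fin n → k}
    (g : (Fin n → k) ≃ₗ[k] (Fin n → k)) (hp : ∀ x, q (g x) = p x) (hp' : ∀ x, q' (g x) = p' x)
    (hl : ∀ x y, (m (g x) * m (g y)) • w = (l x * l y) • g v) :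
    linStr q q' m w ∈ orbit (linStr p p' l v) :=
  mem_orbit_iff.2 ⟨g, fun x y => by simp [hp, hp', hl]⟩

theorem degenerates_linStr_of_collinear [Infinite k] {p p' l m : (Fin n → k) →ₗ[k] k}
    {v f : Fin n → k} (hpf : p f = 0) (hpf' : p' f = 0) (hlf : l f = 1) (hmf : m f = 0)
    (hlv : l v = 0) (hmv : m v = 0) : degenerates (linStr p p' l v) (linStr p p' m v) := by
  have h := degenerates_of_quadratic_curve (μ := linStr p p' l v)
    (fun t => linStr p p' (t • l + m) v) (fun x y i => ⟨p y * x i + p' x * y i + m x * m y * v i,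
      (l x * m y + m x * l y) * v i, l x * l y * v i, fun t => by
        simp only [linStr_apply, LinearMap.add_apply, LinearMap.smul_apply, Pi.add_apply,
          Pi.smul_apply, smul_eq_mul]
        ring⟩) fun t ht => by
    obtain ⟨g, hg⟩ := exists_linearEquiv_add_smul ((t - 1) • l + m) f (by
      simpa [hlf, hmf] using ht)
    refine mem_orbit_symm (linStr_mem_orbit g (fun x => ?_) (fun x => ?_) fun x y => ?_)
    · simp [hg, hpf]
    · simp [hg, hpf']
    · simp only [hg, map_add, map_smul, hlf, hlv, hmv, LinearMap.add_apply, LinearMap.smul_apply,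
        smul_eq_mul]
      module
  simpa using h

theorem degenerates_linStr_zero [Infinite k] {p p' l : (Fin n → k) →ₗ[k] k}
    {v : Fin n → k} (hv : v ≠ 0) (hpv : p v = 0) (hpv' : p' v = 0) (hlv : l v = 0) :
    degenerates (linStr p p' l v) (linStr p p' 0 v) := by
  obtain ⟨ψ, hψ⟩ := Module.Projective.exists_dual_eq_one k hv
  have h := degenerates_of_quadratic_curve (μ := linStr p p' l v)
    (fun t => linStr p p' (t • l) v) (fun x y i => ⟨p y * x i + p' x * y i, 0,
      l x * l y * v i, fun t => by
        simp only [linStr_apply, LinearMap.smul_apply, Pi.add_apply, Pi.smul_apply, smul_eq_mul]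
        ring⟩) fun t ht => by
    obtain ⟨g, hg⟩ := exists_linearEquiv_add_smul ((t ^ 2 - 1) • ψ) v (by simpa [hψ] using ht)
    refine linStr_mem_orbit g (fun x => ?_) (fun x => ?_) fun x y => ?_
    · simp [hg, hpv]
    · simp [hg, hpv']
    · simp only [hg, map_add, map_smul, hlv, hψ, LinearMap.smul_apply, smul_eq_mul]
      module
  simpa using h

theorem degenerates_linStr_left [Infinite k] {p p' : (Fin n → k) →ₗ[k] k}
    {v e : Fin n → k} (hpe : p e = 0) (hpe' : p' e = 1) :
    degenerates (linStr p p' 0 v) (linStr p 0 0 v) := by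
  have h := degenerates_of_quadratic_curve (μ := linStr p p' 0 v)
    (fun t => linStr p (t • p') 0 v) (fun x y i => ⟨p y * x i, p' x * y i, 0, fun t => by
        simp only [linStr_apply, LinearMap.smul_apply, LinearMap.zero_apply, Pi.add_apply,
          Pi.smul_apply, smul_eq_mul]
        ring⟩) fun t ht => by
    obtain ⟨g, hg⟩ := exists_linearEquiv_add_smul ((t - 1) • p') e (by simpa [hpe'] using ht)
    refine mem_orbit_symm (linStr_mem_orbit g (fun x => ?_) (fun x => ?_) fun x y => ?_)
    · simp [hg, hpe]
    · simp only [hg, map_add, map_smul, hpe', LinearMap.smul_apply, smul_eq_mul]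
      ring
    · simp
  simpa using h

/-- Every one-dimensional subspace is a subalgebra. -/
def SquaresProportional (μ : AlgStr k n) : Prop :=
  ∀ x, ∃ c : k, μ x x = c • x

theorem SquaresProportional.of_mem_orbit {μ ν : AlgStr k n} (h : SquaresProportional μ)
    (hν : ν ∈ orbit μ) : SquaresProportional ν := by
  obtain ⟨g, rfl⟩ := hν
  intro x
  obtain ⟨c, hc⟩ := h (g.symm x)
  exact ⟨c, by simp [transport_apply, hc]⟩

theorem squaresProportional_linStr (p p' : (Fin n → k) →ₗ[k] k) (v : Fin n → k) :
    SquaresProportional (linStr p p' 0 v) := fun x =>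
  ⟨p x + p' x, by simp [add_smul]⟩

theorem not_squaresProportional_linStr {p p' l : (Fin n → k) →ₗ[k] k} {v : Fin n → k}
    (hv : v ≠ 0) (hl : l ≠ 0) (hlv : l v = 0) : ¬ SquaresProportional (linStr p p' l v) := by
  intro h
  obtain ⟨x, hx⟩ : ∃ x, l x ≠ 0 := by
    by_contra! hcon
    exact hl (LinearMap.ext hcon)
  obtain ⟨c, hc⟩ := h x
  rw [linStr_apply] at hc
  have h1 := congrArg l hc
  simp only [map_add, map_smul, smul_eq_mul, hlv] at h1
  have h2 : c = p x + p' x := mul_right_cancel₀ hx (by linear_combination -h1)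
  have h3 : (l x * l x) • v = 0 := by
    rw [h2, add_smul] at hc
    simpa using hc
  simp [hx, hv] at h3

/-- Some hyperplane has zero multiplication. -/
def HasZeroHyperplane (μ : AlgStr k n) : Prop :=
  ∃ φ : (Fin n → k) →ₗ[k] k, φ ≠ 0 ∧ ∀ x y, φ x = 0 → φ y = 0 → μ x y = 0

theorem HasZeroHyperplane.of_mem_orbit {μ ν : AlgStr k n} (h : HasZeroHyperplane μ)
    (hν : ν ∈ orbit μ) : HasZeroHyperplane ν := by
  obtain ⟨g, rfl⟩ := hν
  obtain ⟨φ, hφ, H⟩ := h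
  refine ⟨φ ∘ₗ g.symm, fun h0 => hφ (LinearMap.ext fun x => ?_), fun x y hx hy => ?_⟩
  · simpa using LinearMap.congr_fun h0 (g x)
  · rw [transport_apply, show μ (g.symm x) (g.symm y) = 0 from H _ _ hx hy, map_zero]

theorem not_hasZeroHyperplane_linStr_smul {m l : (Fin n → k) →ₗ[k] k} {α β : k} {v f : Fin n → k}
    (hm : m ≠ 0) (hαβ : ¬ (α = 0 ∧ β = 0)) (hv : v ≠ 0) (hlv : l v = 0) (hmv : m v = 0)
    (hlf : l f = 1) (hmf : m f = 0) : ¬ HasZeroHyperplane (linStr (α • m) (β • m) l v) := by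
  rintro ⟨φ, hφ, H⟩
  simp only [linStr_apply, LinearMap.smul_apply, smul_eq_mul] at H
  by_cases hφv : φ v = 0
  · have hmy : ∀ y, φ y = 0 → m y = 0 := fun y hy => by
      have h1 := H v y hφv hy
      have h2 := H y v hy hφv
      simp only [hlv, hmv, mul_zero, zero_mul, zero_smul, add_zero, zero_add, smul_eq_zero, hv,
        or_false, mul_eq_zero] at h1 h2
      tauto
    have hly : ∀ y, φ y = 0 → l y = 0 := fun y hy => by
      simpa [hmy y hy, hv] using H y y hy hy
    obtain ⟨w, hw⟩ : ∃ w, m w ≠ 0 := by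
      by_contra! hcon
      exact hm (LinearMap.ext hcon)
    have h1 := hmy (φ f • w - φ w • f) (by simp [mul_comm])
    have h2 : φ f = 0 := by simpa [hmf, hw] using h1
    simpa [hlf] using hly f h2
  · have hy : φ (f - (φ f / φ v) • v) = 0 := by simp [hφv]
    have h1 := congrArg φ (H _ _ hy hy)
    rw [map_add, map_add, map_smul, map_smul, hy] at h1
    simp [hlf, hlv, hφv] at h1

theorem not_hasZeroHyperplane_linStr_of_independent {p p' l : (Fin n → k) →ₗ[k] k}
    {v f e e' : Fin n → k} (hpe : p e = 0) (hpe' : p' e = 1) (hep : p e' = 1)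
    (hv : v ≠ 0) (hlv : l v = 0) (hpv : p v = 0) (hpv' : p' v = 0) (hlf : l f = 1) (hpf : p f = 0)
    (hpf' : p' f = 0) : ¬ HasZeroHyperplane (linStr p p' 0 v) := by
  rintro ⟨φ, hφ, H⟩
  simp only [linStr_apply, LinearMap.zero_apply, mul_zero, zero_smul, add_zero] at H
  obtain ⟨z, hz, hφz, hpz, hpz'⟩ : ∃ z, z ≠ 0 ∧ φ z = 0 ∧ p z = 0 ∧ p' z = 0 := by
    by_cases hφv : φ v = 0
    · exact ⟨v, hv, hφv, hpv, hpv'⟩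
    · refine ⟨φ v • f - φ f • v, fun h => hφv ?_, by simp [mul_comm], by simp [hpf, hpv],
        by simp [hpf', hpv']⟩
      simpa [hlf, hlv] using congrArg l h
  have hp : ∀ x, φ x = 0 → p x = 0 := fun x hx => by
    simpa [hpz', hz] using H z x hφz hx
  have hp' : ∀ x, φ x = 0 → p' x = 0 := fun x hx => by
    simpa [hpz, hz] using H x z hx hφz
  have h1 := hp (φ e • e' - φ e' • e) (by simp [mul_comm])
  have h2 : φ e = 0 := by simpa [hpe, hep] using h1
  simpa [hpe'] using hp' e h2

theorem exists_smul_or_exists_apply_eq (p p' : (Fin n → k) →ₗ[k] k) (hp : ¬ (p = 0 ∧ p' = 0)) :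
    (∃ (m : (Fin n → k) →ₗ[k] k) (α β : k), m ≠ 0 ∧ ¬ (α = 0 ∧ β = 0) ∧ p = α • m ∧ p' = β • m) ∨
      ∃ e e', p e = 0 ∧ p' e = 1 ∧ p e' = 1 := by
  by_cases h0 : p = 0
  · exact .inl ⟨p', 0, 1, fun h => hp ⟨h0, h⟩, by simp, by simp [h0], by simp⟩
  obtain ⟨w, hw⟩ : ∃ w, p w = 1 := by
    obtain ⟨w, hw⟩ : ∃ w, p w ≠ 0 := by
      by_contra! hcon
      exact h0 (LinearMap.ext hcon)
    exact ⟨(p w)⁻¹ • w, by simp [hw]⟩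
  by_cases h : ∀ x, p x = 0 → p' x = 0
  · refine .inl ⟨p, 1, p' w, h0, by simp, by simp, LinearMap.ext fun x => ?_⟩
    have := h (x - p x • w) (by simp [hw])
    simp only [map_sub, map_smul, smul_eq_mul] at this
    rw [LinearMap.smul_apply, smul_eq_mul]
    linear_combination this
  · push Not at h
    obtain ⟨e, he, he'⟩ := h
    exact .inr ⟨(p' e)⁻¹ • e, w, by simp [he], by simp [he'], hw⟩

theorem hasChain_three_linStr [Infinite k] {p p' l : (Fin n → k) →ₗ[k] k} {v f : Fin n → k}
    (hp : ¬ (p = 0 ∧ p' = 0)) (hv : v ≠ 0) (hpv : p v = 0) (hpv' : p' v = 0) (hlv : l v = 0)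
    (hpf : p f = 0) (hpf' : p' f = 0) (hlf : l f = 1) : hasChain (linStr p p' l v) 3 := by
  rcases exists_smul_or_exists_apply_eq p p' hp with ⟨m, α, β, hm, hαβ, rfl, rfl⟩ | ⟨e, e', he⟩
  · have hmz : ∀ z, α * m z = 0 → β * m z = 0 → m z = 0 := fun z h h' => by
      simp only [mul_eq_zero] at h h'
      tauto
    have hmf : m f = 0 := hmz f hpf hpf'
    have hmv : m v = 0 := hmz v hpv hpv'
    refine hasChain_succ.2 ⟨linStr (α • m) (β • m) m v,
      ⟨degenerates_linStr_of_collinear hpf hpf' hlf hmf hlv hmv, fun h =>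
        not_hasZeroHyperplane_linStr_smul hm hαβ hv hlv hmv hlf hmf
          (HasZeroHyperplane.of_mem_orbit ⟨m, hm, fun x y hx hy => by simp [hx, hy]⟩
            (mem_orbit_symm h))⟩, ?_⟩
    refine hasChain_succ.2 ⟨linStr (α • m) (β • m) 0 v,
      ⟨degenerates_linStr_zero hv hpv hpv' hmv, fun h =>
        not_squaresProportional_linStr hv hm hmv
          ((squaresProportional_linStr _ _ _).of_mem_orbit (mem_orbit_symm h))⟩, ?_⟩
    refine hasChain_one fun h => hαβ ?_
    obtain ⟨w, hw⟩ : ∃ w, m w ≠ 0 := by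
      by_contra! hcon
      exact hm (LinearMap.ext hcon)
    have h1 := LinearMap.congr_fun (LinearMap.congr_fun h w) v
    have h2 := LinearMap.congr_fun (LinearMap.congr_fun h v) w
    simpa [hmv, hw, hv, and_comm] using And.intro h1 h2
  · obtain ⟨hpe, hpe', hep⟩ := he
    have hl : l ≠ 0 := fun h => by simp [h] at hlf
    refine hasChain_succ.2 ⟨linStr p p' 0 v,
      ⟨degenerates_linStr_zero hv hpv hpv' hlv, fun h =>
        not_squaresProportional_linStr hv hl hlv
          ((squaresProportional_linStr _ _ _).of_mem_orbit (mem_orbit_symm h))⟩, ?_⟩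
    refine hasChain_succ.2 ⟨linStr p 0 0 v, ⟨degenerates_linStr_left hpe hpe', fun h =>
      not_hasZeroHyperplane_linStr_of_independent hpe hpe' hep hv hlv hpv hpv' hlf hpf hpf'
        (HasZeroHyperplane.of_mem_orbit ⟨p, fun h => by simp [h] at hep, fun x y hx hy => by
          simp [hy]⟩ (mem_orbit_symm h))⟩, ?_⟩
    refine hasChain_one fun h => hv ?_
    simpa [hep] using LinearMap.congr_fun (LinearMap.congr_fun h v) e'

end LinearStructures
section SquareIdeal

variable {n : ℕ}

theorem coeff_eq_zero_of_quartic [Infinite k] {a b c d e : k}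
    (h : ∀ r : k, a + b * r + c * r ^ 2 + d * r ^ 3 + e * r ^ 4 = 0) :
    a = 0 ∧ b = 0 ∧ c = 0 ∧ e = 0 := by
  have hP : (Polynomial.C a + Polynomial.C b * Polynomial.X + Polynomial.C c * Polynomial.X ^ 2 +
      Polynomial.C d * Polynomial.X ^ 3 + Polynomial.C e * Polynomial.X ^ 4) = 0 :=
    Polynomial.funext fun r => by simpa using h r
  refine ⟨?_, ?_, ?_, ?_⟩
  · simpa [Polynomial.coeff_X, Polynomial.coeff_C] using congrArg (fun P => P.coeff 0) hP
  · simpa [Polynomial.coeff_X, Polynomial.coeff_C] using congrArg (fun P => P.coeff 1) hP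
  · simpa [Polynomial.coeff_X, Polynomial.coeff_C] using congrArg (fun P => P.coeff 2) hP
  · simpa [Polynomial.coeff_X, Polynomial.coeff_C] using congrArg (fun P => P.coeff 4) hP

/-- No triple `(φ, e, u)` as in `degenerates_FabStr` exists. -/
def NoFabTriple (μ : AlgStr k n) : Prop :=
  ∀ (φ : (Fin n → k) →ₗ[k] k) (e u : Fin n → k), φ e = 0 → φ u = 0 → φ (μ e e) = 1 →
    φ (μ u u) = 0 → φ (μ e u) = 0 ∧ φ (μ u e) = 0

theorem NoFabTriple.apply_eq [IsAlgClosed k] {μ : AlgStr k n} (h : NoFabTriple μ)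
    {φ : (Fin n → k) →ₗ[k] k} {e : Fin n → k} (he : φ e = 0) (hee : φ (μ e e) = 1) {x : Fin n → k}
    (hx : φ x = 0) : φ (μ x e) = φ (μ e x) ∧
      ∀ y, φ y = 0 → φ (μ x y) = φ (μ e x) * φ (μ e y) := by
  let b := LinearMap.domRestrict₁₂ (μ.compr₂ φ) (LinearMap.ker φ) (LinearMap.ker φ)
  have hb : ∀ x y : LinearMap.ker φ, b x y = φ (μ x y) := fun _ _ => rfl
  rcases bilinForm_trichotomy b with halt | ⟨e', he', hsym, hsq⟩ | ⟨e', u, hee', huu, hαβ⟩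
  · have := halt ⟨e, he⟩
    rw [hb, hee] at this
    exact absurd this one_ne_zero
  · have key : ∀ x y : LinearMap.ker φ, φ (μ x y) = b e' x * b e' y := hsq
    have h1 := key ⟨e, he⟩ ⟨e, he⟩
    simp only [hee] at h1
    have h2 := key ⟨x, hx⟩ ⟨e, he⟩
    have h3 := key ⟨e, he⟩ ⟨x, hx⟩
    refine ⟨by rw [h2, h3, mul_comm], fun y hy => ?_⟩
    have h4 := key ⟨e, he⟩ ⟨y, hy⟩
    have h5 := key ⟨x, hx⟩ ⟨y, hy⟩
    simp only at h3 h4 h5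
    rw [h3, h4, h5]
    linear_combination (b e' ⟨x, hx⟩ * b e' ⟨y, hy⟩) * h1
  · exact absurd (h φ e' u e'.2 u.2 hee' huu) hαβ

theorem exists_dual_pair {f₁ f₂ : Fin n → k} (h : LinearIndependent k ![f₁, f₂]) :
    ∃ ψ φ : (Fin n → k) →ₗ[k] k, ψ f₁ = 1 ∧ ψ f₂ = 0 ∧ φ f₁ = 0 ∧ φ f₂ = 1 := by
  obtain ⟨g, hg⟩ := LinearMap.exists_leftInverse_of_injective
    (Fintype.linearCombination k ![f₁, f₂])
    (LinearMap.ker_eq_bot.2 h.fintypeLinearCombination_injective)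
  have h1 : g f₁ = Pi.single 0 1 := by
    simpa [Fintype.linearCombination_apply_single] using LinearMap.congr_fun hg (Pi.single 0 1)
  have h2 : g f₂ = Pi.single 1 1 := by
    simpa [Fintype.linearCombination_apply_single] using LinearMap.congr_fun hg (Pi.single 1 1)
  exact ⟨LinearMap.proj 0 ∘ₗ g, LinearMap.proj 1 ∘ₗ g, by simp [h1], by simp [h2], by simp [h1],
    by simp [h2]⟩

theorem NoFabTriple.exists_eq_linStr [IsAlgClosed k] {μ : AlgStr k n} (h : NoFabTriple μ)
    {f₁ f₂ : Fin n → k} (hind : LinearIndependent k ![f₁, f₂])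
    (hI₁ : ∀ y, μ f₁ y ∈ Submodule.span k {f₁, f₂} ∧ μ y f₁ ∈ Submodule.span k {f₁, f₂})
    (hI₂ : ∀ y, μ f₂ y ∈ Submodule.span k {f₁, f₂} ∧ μ y f₂ ∈ Submodule.span k {f₁, f₂})
    (h11 : μ f₁ f₁ = f₂) (h12 : μ f₁ f₂ = 0) (h21 : μ f₂ f₁ = 0) (h22 : μ f₂ f₂ = 0) :
    ∃ p p' l : (Fin n → k) →ₗ[k] k, μ = linStr p p' l f₂ ∧ p f₁ = 0 ∧ p' f₁ = 0 ∧ l f₁ = 1 ∧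
      p f₂ = 0 ∧ p' f₂ = 0 ∧ l f₂ = 0 := by
  have : Infinite k := IsAlgClosed.instInfinite
  obtain ⟨ψ, φ₀, hψ1, hψ2, hφ1, hφ2⟩ := exists_dual_pair hind
  have hcoord : ∀ z ∈ Submodule.span k {f₁, f₂}, z = ψ z • f₁ + φ₀ z • f₂ := fun z hz => by
    obtain ⟨a, b, rfl⟩ := Submodule.mem_span_pair.1 hz
    simp [hψ1, hψ2, hφ1, hφ2]
  obtain ⟨p, hp⟩ : ∃ p : (Fin n → k) →ₗ[k] k, ∀ x, p x = ψ (μ f₁ x) := ⟨ψ ∘ₗ μ f₁, fun _ => rfl⟩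
  obtain ⟨l, hl⟩ : ∃ p : (Fin n → k) →ₗ[k] k, ∀ x, p x = φ₀ (μ f₁ x) := ⟨φ₀ ∘ₗ μ f₁, fun _ => rfl⟩
  obtain ⟨a, ha⟩ : ∃ p : (Fin n → k) →ₗ[k] k, ∀ x, p x = ψ (μ f₂ x) := ⟨ψ ∘ₗ μ f₂, fun _ => rfl⟩
  obtain ⟨c, hc⟩ : ∃ p : (Fin n → k) →ₗ[k] k, ∀ x, p x = φ₀ (μ f₂ x) := ⟨φ₀ ∘ₗ μ f₂, fun _ => rfl⟩
  obtain ⟨p', hp'⟩ : ∃ p : (Fin n → k) →ₗ[k] k, ∀ x, p x = ψ (μ x f₁) :=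
    ⟨ψ ∘ₗ μ.flip f₁, fun _ => rfl⟩
  obtain ⟨l', hl'⟩ : ∃ p : (Fin n → k) →ₗ[k] k, ∀ x, p x = φ₀ (μ x f₁) :=
    ⟨φ₀ ∘ₗ μ.flip f₁, fun _ => rfl⟩
  obtain ⟨a', ha'⟩ : ∃ p : (Fin n → k) →ₗ[k] k, ∀ x, p x = ψ (μ x f₂) :=
    ⟨ψ ∘ₗ μ.flip f₂, fun _ => rfl⟩
  obtain ⟨c', hc'⟩ : ∃ p : (Fin n → k) →ₗ[k] k, ∀ x, p x = φ₀ (μ x f₂) :=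
    ⟨φ₀ ∘ₗ μ.flip f₂, fun _ => rfl⟩
  have hf1x : ∀ x, μ f₁ x = p x • f₁ + l x • f₂ := fun x => by
    rw [hp, hl]; exact hcoord _ (hI₁ x).1
  have hxf1 : ∀ x, μ x f₁ = p' x • f₁ + l' x • f₂ := fun x => by
    rw [hp', hl']; exact hcoord _ (hI₁ x).2
  have hf2x : ∀ x, μ f₂ x = a x • f₁ + c x • f₂ := fun x => by
    rw [ha, hc]; exact hcoord _ (hI₂ x).1
  have hxf2 : ∀ x, μ x f₂ = a' x • f₁ + c' x • f₂ := fun x => by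
    rw [ha', hc']; exact hcoord _ (hI₂ x).2
  have hpf1 : p f₁ = 0 := by rw [hp, h11, hψ2]
  have hpf1' : p' f₁ = 0 := by rw [hp', h11, hψ2]
  have hlf1 : l f₁ = 1 := by rw [hl, h11, hφ2]
  have hpf2 : p f₂ = 0 := by rw [hp, h12, map_zero]
  have hpf2' : p' f₂ = 0 := by rw [hp', h21, map_zero]
  have hlf2 : l f₂ = 0 := by rw [hl, h12, map_zero]
  clear hp hl ha hc hp' hl' ha' hc'
  have key : ∀ φ : (Fin n → k) →ₗ[k] k, φ f₂ = 1 → ∀ x,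
      p' x * φ f₁ + l' x - φ f₁ * (a' x * φ f₁ + c' x) =
        p x * φ f₁ + l x - φ f₁ * (a x * φ f₁ + c x) ∧
      ∀ y, φ (μ x y) = φ x * (a y * φ f₁ + c y) + φ y * (a' x * φ f₁ + c' x) +
        (p x * φ f₁ + l x - φ f₁ * (a x * φ f₁ + c x)) *
        (p y * φ f₁ + l y - φ f₁ * (a y * φ f₁ + c y)) := by
    intro φ hφ x
    have he : φ (f₁ - φ f₁ • f₂) = 0 := by simp [hφ]
    have hbar : ∀ z, φ (z - φ z • f₂) = 0 := fun z => by simp [hφ]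
    have hee : φ (μ (f₁ - φ f₁ • f₂) (f₁ - φ f₁ • f₂)) = 1 := by
      simp [h11, h12, h21, h22, hφ]
    have hex : ∀ z, φ (μ (f₁ - φ f₁ • f₂) (z - φ z • f₂)) =
        p z * φ f₁ + l z - φ f₁ * (a z * φ f₁ + c z) := fun z => by
      simp [h12, h22, hf1x z, hf2x z, hφ]
      ring
    have hxe : φ (μ (x - φ x • f₂) (f₁ - φ f₁ • f₂)) =
        p' x * φ f₁ + l' x - φ f₁ * (a' x * φ f₁ + c' x) := by
      simp [h21, h22, hxf1 x, hxf2 x, hφ]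
      ring
    obtain ⟨h1, h2⟩ := h.apply_eq he hee (hbar x)
    rw [hxe, hex] at h1
    refine ⟨h1, fun y => ?_⟩
    have h3 := h2 _ (hbar y)
    rw [hex, hex] at h3
    rw [← h3]
    simp [h22, hf2x y, hxf2 x, hφ]
    ring
  have hr : ∀ r : k, (φ₀ + r • ψ) f₁ = r := fun r => by simp [hφ1, hψ1]
  have hr2 : ∀ r : k, (φ₀ + r • ψ) f₂ = 1 := fun r => by simp [hφ2, hψ2]
  have ha : ∀ x, a x = 0 := fun x => by
    have := (coeff_eq_zero_of_quartic
      (a := φ₀ x * c x + φ₀ x * c' x + l x * l x - φ₀ (μ x x))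
      (b := φ₀ x * a x + ψ x * c x + φ₀ x * a' x + ψ x * c' x + 2 * l x * (p x - c x) - ψ (μ x x))
      (c := ψ x * a x + ψ x * a' x + (p x - c x) ^ 2 - 2 * l x * a x)
      (d := -2 * a x * (p x - c x)) (e := a x * a x) fun r => by
        have := (key _ (hr2 r) x).2 x
        rw [hr] at this
        simp only [LinearMap.add_apply, LinearMap.smul_apply, smul_eq_mul] at this
        linear_combination -this).2.2.2
    simpa using this
  have hsymm : ∀ x, l' x = l x ∧ p' x - c' x = p x - c x ∧ a' x = 0 := fun x => by
    obtain ⟨h1, h2, h3, -⟩ := coeff_eq_zero_of_quartic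
      (a := l' x - l x) (b := p' x - c' x - (p x - c x)) (c := a x - a' x) (d := 0) (e := 0)
      fun r => by
        have := (key _ (hr2 r) x).1
        rw [hr] at this
        linear_combination this
    rw [ha] at h3
    exact ⟨sub_eq_zero.1 h1, sub_eq_zero.1 h2, by linear_combination -h3⟩
  have hcp : ∀ x, c x = p x := fun x => by
    have := (coeff_eq_zero_of_quartic
      (a := φ₀ x * c x + φ₀ x * c' x + l x * l x - φ₀ (μ x x))
      (b := ψ x * c x + ψ x * c' x + 2 * l x * (p x - c x) - ψ (μ x x))
      (c := (p x - c x) ^ 2) (d := 0) (e := 0) fun r => by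
        have := (key _ (hr2 r) x).2 x
        rw [hr, ha, (hsymm x).2.2] at this
        simp only [LinearMap.add_apply, LinearMap.smul_apply, smul_eq_mul] at this
        linear_combination -this).2.2.1
    exact (sub_eq_zero.1 (pow_eq_zero_iff two_ne_zero |>.1 this)).symm
  have hcp' : ∀ x, c' x = p' x := fun x => by
    linear_combination hcp x - (hsymm x).2.1
  refine ⟨p, p', l, LinearMap.ext fun x => LinearMap.ext fun y => ?_, hpf1, hpf1', hlf1, hpf2,
    hpf2', hlf2⟩
  have hφ : ∀ φ : (Fin n → k) →ₗ[k] k, φ f₂ = 1 → φ (μ x y - linStr p p' l f₂ x y) = 0 := by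
    intro φ hφ
    have := (key φ hφ x).2 y
    simp only [ha, (hsymm x).2.2, hcp, hcp'] at this
    simp only [linStr_apply, map_sub, map_add, map_smul, smul_eq_mul, hφ]
    linear_combination this
  refine sub_eq_zero.1 ((Module.forall_dual_apply_eq_zero_iff k _).1 fun φ => ?_)
  have h1 := hφ φ₀ hφ2
  have h2 := hφ (φ + (1 - φ f₂) • φ₀) (by simp [hφ2])
  rw [LinearMap.add_apply, LinearMap.smul_apply, h1] at h2
  simpa using h2

theorem levelIs_two_mem_orbit_FabStr [IsAlgClosed k] (hn : 3 ≤ n) {μ : AlgStr k n}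
    (hμ : levelIs μ 2) {f₁ f₂ : Fin n → k} (hind : LinearIndependent k ![f₁, f₂])
    (hI₁ : ∀ y, μ f₁ y ∈ Submodule.span k {f₁, f₂} ∧ μ y f₁ ∈ Submodule.span k {f₁, f₂})
    (hI₂ : ∀ y, μ f₂ y ∈ Submodule.span k {f₁, f₂} ∧ μ y f₂ ∈ Submodule.span k {f₁, f₂})
    (h11 : μ f₁ f₁ = f₂) (h12 : μ f₁ f₂ = 0) (h21 : μ f₂ f₁ = 0) (h22 : μ f₂ f₂ = 0) :
    ∃ α β : k, (α, β) ≠ (0, 0) ∧ μ ∈ orbit (FabStr n α β) := by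
  have : Infinite k := IsAlgClosed.instInfinite
  by_cases hT : NoFabTriple μ
  · exfalso
    obtain ⟨p, p', l, rfl, hp1, hp1', hl1, hp2, hp2', hl2⟩ :=
      hT.exists_eq_linStr hind hI₁ hI₂ h11 h12 h21 h22
    have hf2 : f₂ ≠ 0 := by simpa using hind.ne_zero 1
    by_cases hp : p = 0 ∧ p' = 0
    · refine not_hasChain_two_FabStr_zero_zero hn ((hasChain_congr
        (mem_orbit_FabStr_zero_zero hn hf2 hl2 hl1 fun x y => ?_) 2).1 hμ.1)
      simp [hp.1, hp.2]
    · exact hμ.2 (hasChain_three_linStr hp hf2 hp2 hp2' hl2 hp1 hp1' hl1)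
  · simp only [NoFabTriple, not_forall] at hT
    obtain ⟨φ, e, u, he, hu, hee, huu, hαβ⟩ := hT
    refine ⟨φ (μ e u), φ (μ u e), by simpa using hαβ, ?_⟩
    by_contra hmem
    exact hμ.2 (hasChain_succ.2 ⟨_, ⟨degenerates_FabStr hn μ φ he hu hee huu hαβ, fun h =>
      hmem (mem_orbit_symm h)⟩, hasChain_two_FabStr hn (by simpa using hαβ)⟩)

end SquareIdeal
/-! ## STATEMENT 18 -/
theorem stmt18 {k : Type*} [Field k] [IsAlgClosed k] (n : ℕ) (hn : 3 ≤ n)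
    (μ : AlgStr k n)
    (hid : ∃ I : Submodule k (Fin n → k), Module.finrank k ↥I = 2 ∧
      (∀ x ∈ I, ∀ y : Fin n → k, μ x y ∈ I ∧ μ y x ∈ I) ∧
      ∃ f1 f2 : Fin n → k, Submodule.span k {f1, f2} = I ∧
        μ f1 f1 = f2 ∧ μ f1 f2 = 0 ∧ μ f2 f1 = 0 ∧ μ f2 f2 = 0) :
    (levelIs μ 2 ↔ ∃ α β : k, (α, β) ≠ (0, 0) ∧ μ ∈ orbit (FabStr n α β)) := by
  obtain ⟨I, hI, hideal, f₁, f₂, rfl, h11, h12, h21, h22⟩ := hid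
  have hind : LinearIndependent k ![f₁, f₂] := by
    rw [linearIndependent_iff_card_eq_finrank_span]
    rw [show Set.range ![f₁, f₂] = {f₁, f₂} from by
      rw [Matrix.range_cons, Matrix.range_cons, Matrix.range_empty, Set.union_empty]; rfl]
    simpa [Set.finrank] using hI.symm
  refine ⟨fun hμ => levelIs_two_mem_orbit_FabStr hn hμ hind
    (hideal f₁ (Submodule.subset_span (by simp))) (hideal f₂ (Submodule.subset_span (by simp)))
    h11 h12 h21 h22, ?_⟩
  rintro ⟨α, β, hαβ, hμ⟩
  exact levelIs_two_of_mem_orbit_FabStr hn hαβ hμ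

end
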